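/- arXiv:1202.0747 — 3 statements merged into one kernel-verified Lean document; each statement's English description precedes it below -/
import Mathlib

section
/- For all positive integers k and n with n ≥ (3k - 1)/4, M(1,...,1,n) with k ones equals nk + ⌊k²/4⌋. -/
/-- A finite directed multigraph. -/
structure MultiDigraph where
  V : Type
  E : Type
  fintV : Fintype V
  fintE : Fintype E
  src : E → V
  dst : E → V

namespace MultiDigraph

/-- `p` is a (nonempty) directed path from `u` to `v`, given as its list of edges. -/
def IsPathFrom (G : MultiDigraph) (u v : G.V) (p : List G.E) : Prop :=
  p ≠ [] ∧ List.Chain' (fun e f => G.dst e = G.src f) p ∧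
    (∀ e ∈ p.head?, G.src e = u) ∧ ∀ e ∈ p.getLast?, G.dst e = v

/-- `G` is acyclic: there is no (nonempty) directed path from a vertex to itself. -/
def Acyclic (G : MultiDigraph) : Prop :=
  ∀ (v : G.V) (p : List G.E), ¬ G.IsPathFrom v v p

/-- `α` is a family of `c` pairwise edge-disjoint directed paths from `u` to `v`. -/
def MengerSystem (G : MultiDigraph) (u v : G.V) (c : ℕ) (α : Fin c → List G.E) : Prop :=
  (∀ i, G.IsPathFrom u v (α i)) ∧ ∀ i j, i ≠ j → ∀ e, e ∈ α i → e ∉ α j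

/-- The min-cut between `u` and `v` equals `c`: by Menger's theorem, this means the
maximum number of pairwise edge-disjoint directed paths from `u` to `v` is exactly `c`. -/
def MinCut (G : MultiDigraph) (u v : G.V) (c : ℕ) : Prop :=
  (∃ α : Fin c → List G.E, G.MengerSystem u v c α) ∧
    ¬∃ α : Fin (c + 1) → List G.E, G.MengerSystem u v (c + 1) α

/-- Edge `e` is the starting edge of a merging among paths from (at least) two different
groups: `e` lies on a path of group `i` and on a path of group `j ≠ i`, and there are two
distinct edges immediately ahead of `e` on these two paths.  Mergings are counted without
multiplicity: one merging per such edge `e`. -/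
def MergingEdge (G : MultiDigraph) {l : ℕ} {c : Fin l → ℕ}
    (α : (i : Fin l) → Fin (c i) → List G.E) (e : G.E) : Prop :=
  ∃ i j : Fin l, i ≠ j ∧ ∃ (a : Fin (c i)) (b : Fin (c j)) (f g : G.E),
    f ≠ g ∧ [f, e] <:+: α i a ∧ [g, e] <:+: α j b

/-- The number of mergings among paths from different groups, `|G|_M(α₁,…,α_l)`. -/
noncomputable def mergingCount (G : MultiDigraph) {l : ℕ} {c : Fin l → ℕ}
    (α : (i : Fin l) → Fin (c i) → List G.E) : ℕ :=
  Set.ncard {e : G.E | G.MergingEdge α e}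

end MultiDigraph

open MultiDigraph

/-- `G` is a finite acyclic directed multigraph with designated sources `S i`, pairwise
distinct sinks `R i`, and min-cut `c i` between `S i` and `R i`. -/
def GoodConfig {l : ℕ} (G : MultiDigraph) (S R : Fin l → G.V) (c : Fin l → ℕ) : Prop :=
  G.Acyclic ∧ Function.Injective R ∧ ∀ i, G.MinCut (S i) (R i) (c i)

/-- `M(c₁,…,c_l) ≤ B`: in every acyclic graph with distinct sources, distinct sinks and
the given min-cuts, some choice of Menger path systems yields at most `B` mergings. -/
def MAtMost {l : ℕ} (c : Fin l → ℕ) (B : ℕ) : Prop :=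
  ∀ (G : MultiDigraph) (S R : Fin l → G.V), GoodConfig G S R c → Function.Injective S →
    ∃ α : (i : Fin l) → Fin (c i) → List G.E,
      (∀ i, G.MengerSystem (S i) (R i) (c i) (α i)) ∧ G.mergingCount α ≤ B

/-- `M(c₁,…,c_l) ≥ B`: some acyclic graph with distinct sources, distinct sinks and the
given min-cuts yields at least `B` mergings for every choice of Menger path systems. -/
def MAtLeast {l : ℕ} (c : Fin l → ℕ) (B : ℕ) : Prop :=
  ∃ (G : MultiDigraph) (S R : Fin l → G.V), GoodConfig G S R c ∧ Function.Injective S ∧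
    ∀ α : (i : Fin l) → Fin (c i) → List G.E,
      (∀ i, G.MengerSystem (S i) (R i) (c i) (α i)) → B ≤ G.mergingCount α

/-- `M(c₁,…,c_l) = B`: the largest possible value, over all acyclic graphs with distinct
sources and distinct sinks realizing the min-cuts `c`, of the minimum number of mergings
over all choices of Menger path systems, equals `B`. -/
def MEq {l : ℕ} (c : Fin l → ℕ) (B : ℕ) : Prop := MAtMost c B ∧ MAtLeast c B

/-- `M*(c₁,…,c_l) ≤ B`: as `MAtMost`, but with all sources identical. -/
def MstarAtMost {l : ℕ} (c : Fin l → ℕ) (B : ℕ) : Prop :=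
  ∀ (G : MultiDigraph) (S R : Fin l → G.V), GoodConfig G S R c → (∀ i j, S i = S j) →
    ∃ α : (i : Fin l) → Fin (c i) → List G.E,
      (∀ i, G.MengerSystem (S i) (R i) (c i) (α i)) ∧ G.mergingCount α ≤ B

/-- `M*(c₁,…,c_l) ≥ B`: as `MAtLeast`, but with all sources identical. -/
def MstarAtLeast {l : ℕ} (c : Fin l → ℕ) (B : ℕ) : Prop :=
  ∃ (G : MultiDigraph) (S R : Fin l → G.V), GoodConfig G S R c ∧ (∀ i j, S i = S j) ∧
    ∀ α : (i : Fin l) → Fin (c i) → List G.E,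
      (∀ i, G.MengerSystem (S i) (R i) (c i) (α i)) → B ≤ G.mergingCount α

/-- `M*(c₁,…,c_l) = B`: as `MEq`, but with all sources identical. -/
def MstarEq {l : ℕ} (c : Fin l → ℕ) (B : ℕ) : Prop := MstarAtMost c B ∧ MstarAtLeast c B

namespace MOnes

theorem mantel (k : ℕ) (G : SimpleGraph (Fin k)) [DecidableRel G.Adj] (h : G.CliqueFree 3) :
    G.edgeFinset.card ≤ k ^ 2 / 4 := by
  have := SimpleGraph.CliqueFree.card_edgeFinset_le (r := 2) h
  simp at this
  rcases Nat.mod_two_eq_zero_or_one k with h | h <;> rw [h] at this <;> simp at this <;> grind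

theorem chain_iff {α : Type*} {R : α → α → Prop} {l : List α} :
    List.IsChain R l ↔ ∀ a b, [a, b] <:+: l → R a b := by
  rw [List.isChain_iff_forall_rel_of_append_cons_cons]
  constructor
  · rintro h a b ⟨s, t, rfl⟩
    exact h (l₁ := s) (l₂ := t) (by simp)
  · rintro h a b l1 l2 rfl
    exact h a b ⟨l1, l2, by simp⟩

variable {G : MultiDigraph}

theorem path_iff {u v : G.V} {p : List G.E} : G.IsPathFrom u v p ↔
    p ≠ [] ∧ List.IsChain (fun e f => G.dst e = G.src f) p ∧
    (∀ e ∈ p.head?, G.src e = u) ∧ ∀ e ∈ p.getLast?, G.dst e = v := Iff.rfl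

theorem path_single (e : G.E) : G.IsPathFrom (G.src e) (G.dst e) [e] := by
  simp [path_iff]

theorem path_append {u v w : G.V} {p q : List G.E} (hp : G.IsPathFrom u v p)
    (hq : G.IsPathFrom v w q) : G.IsPathFrom u w (p ++ q) := by
  rw [path_iff] at *
  obtain ⟨p0, pc, ph, pl⟩ := hp
  obtain ⟨q0, qc, qh, ql⟩ := hq
  refine ⟨by simp [p0], ?_, ?_, ?_⟩
  · rw [List.isChain_append]
    refine ⟨pc, qc, fun x hx y hy => ?_⟩
    rw [pl x hx, qh y hy]
  · intro e he
    rw [List.head?_append_of_ne_nil _ p0] at he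
    exact ph e he
  · intro e he
    rw [List.getLast?_append_of_ne_nil _ q0] at he
    exact ql e he

theorem path_tail {u v : G.V} {e : G.E} {p : List G.E} (h : G.IsPathFrom u v (e :: p)) :
    G.src e = u ∧ ((p = [] ∧ G.dst e = v) ∨ G.IsPathFrom (G.dst e) v p) := by
  rw [path_iff] at h
  obtain ⟨-, hc, hh, hl⟩ := h
  refine ⟨hh e (by simp), ?_⟩
  cases p with
  | nil => left; exact ⟨rfl, hl e (by simp)⟩
  | cons f q =>
    right
    rw [List.isChain_cons_cons] at hc
    rw [path_iff]
    refine ⟨by simp, hc.2, ?_, ?_⟩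
    · intro x hx
      simp at hx
      rw [← hx, hc.1]
    · intro x hx
      exact hl x (by simpa using hx)

theorem trans_path {e f : G.E} (h : Relation.TransGen (fun e f => G.dst e = G.src f) e f) :
    ∃ p, G.IsPathFrom (G.src e) (G.src f) p := by
  induction h with
  | single h => exact ⟨[e], by have := path_single e; rwa [h] at this⟩
  | tail _ h ih =>
    rename_i b c _
    obtain ⟨p, hp⟩ := ih
    refine ⟨p ++ [b], path_append hp ?_⟩
    have := path_single b
    rwa [h] at this

theorem no_loop (hG : G.Acyclic) {e : G.E}
    (h : Relation.TransGen (fun e f => G.dst e = G.src f) e e) : False := by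
  obtain ⟨p, hp⟩ := trans_path h
  exact hG _ _ hp

theorem path_pairwise {u v : G.V} {p : List G.E} (h : G.IsPathFrom u v p) :
    p.Pairwise (Relation.TransGen (fun e f => G.dst e = G.src f)) := by
  rw [← List.isChain_iff_pairwise]
  exact (path_iff.1 h).2.1.imp fun a b hab => Relation.TransGen.single hab

theorem path_nodup (hG : G.Acyclic) {u v : G.V} {p : List G.E} (h : G.IsPathFrom u v p) :
    p.Nodup := by
  refine (path_pairwise h).imp ?_
  rintro a b hab rfl
  exact no_loop hG hab

theorem pred_unique {α : Type*} {p : List α} (h : p.Nodup) {x y e : α} (hx : [x, e] <:+: p)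
    (hy : [y, e] <:+: p) : x = y := by
  obtain ⟨s, t, rfl⟩ := hx
  obtain ⟨s', t', h'⟩ := hy
  have e1 : s ++ [x, e] ++ t = (s ++ [x]) ++ e :: t := by simp
  have e2 : s' ++ [y, e] ++ t' = (s' ++ [y]) ++ e :: t' := by simp
  rw [e1] at h h'
  rw [e2] at h'
  have hn : e ∉ s ++ [x] ∧ e ∉ t := by
    rw [List.nodup_append] at h
    obtain ⟨h1, h2, h3⟩ := h
    rw [List.nodup_cons] at h2
    exact ⟨fun hh => h3 e hh e (by simp) rfl, h2.1⟩
  have := (List.append_cons_inj_of_notMem hn.1 hn.2).1 h'.symm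
  have := this.1
  have := List.append_inj_right' this rfl
  simpa using this

/-- order on a list: two distinct members `e`, `e'`. -/
theorem list_order {α : Type*} {H : α → α → Prop} {p : List α} (hc : List.IsChain H p) {e e' : α}
    (he : e ∈ p) (he' : e' ∈ p) (hne : e ≠ e') :
    (∃ f, [f, e'] <:+: p ∧ Relation.ReflTransGen H e f) ∨
    (∃ f, [f, e] <:+: p ∧ Relation.ReflTransGen H e' f) := by
  induction p with
  | nil => simp at he
  | cons a q ih =>
    have key : ∀ (a : α) (q : List α), List.IsChain H (a :: q) → ∀ b ∈ q,
        ∃ f, [f, b] <:+: a :: q ∧ Relation.ReflTransGen H a f := by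
      intro a q
      induction q generalizing a with
      | nil => simp
      | cons c r ih2 =>
        intro hc b hb
        rw [List.isChain_cons_cons] at hc
        rcases List.mem_cons.1 hb with rfl | hb
        · exact ⟨a, ⟨[], r, by simp⟩, .refl⟩
        · obtain ⟨f, hf, hr⟩ := ih2 c hc.2 b hb
          exact ⟨f, hf.trans (List.suffix_cons _ _).isInfix, .head hc.1 hr⟩
    rcases List.mem_cons.1 he with rfl | he1
    · rcases List.mem_cons.1 he' with rfl | he1'
      · exact absurd rfl hne
      · exact .inl (key _ _ hc _ he1')
    · rcases List.mem_cons.1 he' with rfl | he1'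
      · exact .inr (key _ _ hc _ he1)
      · have hc' : List.IsChain H q := by
          have := hc.tail
          simpa using this
        rcases ih hc' he1 he1' with ⟨f, hf, hr⟩ | ⟨f, hf, hr⟩
        · exact .inl ⟨f, hf.trans (List.suffix_cons _ _).isInfix, hr⟩
        · exact .inr ⟨f, hf.trans (List.suffix_cons _ _).isInfix, hr⟩

/-- surgery -/
theorem surgery {H : G.E → G.E → Prop} (hH : ∀ f e, H f e → G.dst f = G.src e) {u v : G.V}
    {p : List G.E} (hp : G.IsPathFrom u v p) (hc : List.IsChain H p) {e0 f e' : G.E}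
    (h0 : e0 ∈ p) (h1 : e' ∈ p) (hr : Relation.ReflTransGen H e0 f) (hf : H f e') :
    ∃ q, G.IsPathFrom u v q ∧ List.IsChain H q ∧ [f, e'] <:+: q := by
  obtain ⟨l, hl, hlast⟩ := List.exists_isChain_cons_of_relationReflTransGen hr
  obtain ⟨p1, p2, hp12⟩ := List.append_of_mem h0
  obtain ⟨q1, q2, hq12⟩ := List.append_of_mem h1
  have c1 := hc
  rw [hp12, List.isChain_append] at c1
  have c2 := hc
  rw [hq12, List.isChain_append] at c2
  have hll : (e0 :: l).getLast? = some f := by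
    rw [List.getLast?_eq_some_getLast (by simp), hlast]
  have hchain : List.IsChain H (p1 ++ ((e0 :: l) ++ (e' :: q2))) := by
    rw [List.isChain_append, List.isChain_append]
    refine ⟨c1.1, ⟨hl, c2.2.1, ?_⟩, ?_⟩
    · intro x hx y hy
      rw [hll] at hx
      simp at hx hy
      rw [← hx, ← hy]; exact hf
    · intro x hx y hy
      exact c1.2.2 x hx y (by simpa using hy)
  obtain ⟨-, -, ph, pl⟩ := path_iff.1 hp
  refine ⟨p1 ++ ((e0 :: l) ++ (e' :: q2)), ?_, hchain, ?_⟩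
  · rw [path_iff]
    refine ⟨by simp, hchain.imp hH, ?_, ?_⟩
    · intro x hx
      apply ph
      rw [hp12]
      cases p1 <;> simpa using hx
    · intro x hx
      apply pl
      rw [hq12]
      rw [← List.append_assoc, List.getLast?_append_of_ne_nil _ (by simp)] at hx
      rw [List.getLast?_append_of_ne_nil _ (by simp)]
      exact hx
  · obtain ⟨d, hd⟩ : ∃ d, e0 :: l = d ++ [f] := by
      refine ⟨(e0 :: l).dropLast, ?_⟩
      rw [← hlast]; exact (List.dropLast_append_getLast (by simp)).symm
    rw [hd]
    exact ⟨p1 ++ d, q2, by simp⟩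

section Upper

variable {k n : ℕ} (S R : Fin k → G.V) (A : Fin n → List G.E)

def HA (f e : G.E) : Prop := ∃ a, [f, e] <:+: A a

def HH (B : Fin k → List G.E) (f e : G.E) : Prop := HA A f e ∨ ∃ i, [f, e] <:+: B i

def Crit (B : Fin k → List G.E) (i : Fin k) (f e : G.E) : Prop :=
  ¬ HA A f e ∧ ∀ p, G.IsPathFrom (S i) (R i) p → List.IsChain (HH A B) p → [f, e] <:+: p

theorem exists_min (B0 : ∀ i, ∃ p, G.IsPathFrom (S i) (R i) p) :
    ∃ B : Fin k → List G.E, (∀ i, G.IsPathFrom (S i) (R i) (B i)) ∧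
      ∀ f e, HH A B f e → ¬ HA A f e → ∃ i, Crit S R A B i f e := by
  classical
  have := G.fintE
  let μ : (Fin k → List G.E) → ℕ := fun B =>
    Set.ncard {x : G.E × G.E | ¬ HA A x.1 x.2 ∧ ∃ i, [x.1, x.2] <:+: B i}
  choose B1 hB1 using B0
  obtain ⟨B, hB, hmin⟩ := WellFounded.has_min (measure μ).wf
    {B | ∀ i, G.IsPathFrom (S i) (R i) (B i)} ⟨B1, hB1⟩
  refine ⟨B, hB, ?_⟩
  intro f e hfe hna
  by_contra hcon
  simp only [Crit, not_exists, not_and, not_forall] at hcon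
  choose p hp hpc hpn using fun i => hcon i hna
  refine hmin p hp ?_
  refine Set.ncard_lt_ncard (Set.ssubset_iff_of_subset ?_ |>.2 ⟨(f, e), ⟨hna, ?_⟩, ?_⟩)
  · rintro ⟨x, y⟩ ⟨h1, i, h2⟩
    refine ⟨h1, ?_⟩
    rcases chain_iff.1 (hpc i) x y h2 with h | h
    · exact absurd h h1
    · exact h
  · rcases hfe with h | h
    · exact absurd h hna
    · exact h
  · rintro ⟨-, i, h⟩
    exact hpn i h

variable {S R A}
variable {B : Fin k → List G.E} (hG : G.Acyclic) (hB : ∀ i, G.IsPathFrom (S i) (R i) (B i))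
  {s r : G.V} (hA : G.MengerSystem s r n A)
include hB hA

theorem HH_adj {f e : G.E} (h : HH A B f e) : G.dst f = G.src e := by
  rcases h with ⟨a, h⟩ | ⟨i, h⟩
  · exact chain_iff.1 (path_iff.1 (hA.1 a)).2.1 _ _ h
  · exact chain_iff.1 (path_iff.1 (hB i)).2.1 _ _ h

omit hA in
theorem crit_infix {i : Fin k} {f e : G.E} (h : Crit S R A B i f e) : [f, e] <:+: B i :=
  h.2 _ (hB i) (chain_iff.2 fun _ _ h => .inr ⟨i, h⟩)

omit hA in
theorem crit_mem {i : Fin k} {f e : G.E} (h : Crit S R A B i f e) : e ∈ B i :=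
  (crit_infix hB h).subset (by simp)

include hG

theorem key {i : Fin k} {f g e e0 : G.E} (hc : Crit S R A B i g e) (h0 : e0 ∈ B i)
    (hr : Relation.ReflTransGen (HH A B) e0 f) (hf : HH A B f e) : f = g := by
  obtain ⟨q, hq, hqc, hqi⟩ := surgery (fun f e h => HH_adj hB hA h) (hB i)
    (chain_iff.2 fun _ _ h => .inr ⟨i, h⟩) h0 (crit_mem hB hc) hr hf
  exact pred_unique (path_nodup hG hq) hqi (hc.2 q hq hqc)

theorem caseA {i : Fin k} {a : Fin n} {h h' e e' : G.E} (he : e ∈ A a) (he' : e' ∈ A a)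
    (hc : Crit S R A B i h e) (hc' : Crit S R A B i h' e') : e = e' := by
  by_contra hne
  have hch : List.IsChain (HH A B) (A a) := chain_iff.2 fun _ _ h => .inl ⟨a, h⟩
  rcases list_order hch he he' hne with ⟨f, hf, hr⟩ | ⟨f, hf, hr⟩
  · have := key hG hB hA hc' (crit_mem hB hc) hr (.inl ⟨a, hf⟩)
    subst this
    exact hc'.1 ⟨a, hf⟩
  · have := key hG hB hA hc (crit_mem hB hc') hr (.inl ⟨a, hf⟩)
    subst this
    exact hc.1 ⟨a, hf⟩

omit hG hB hA in
def CPair (S R : Fin k → G.V) (A : Fin n → List G.E) (B : Fin k → List G.E) (e : G.E)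
    (i j : Fin k) : Prop := ∃ f g, f ≠ g ∧ Crit S R A B i f e ∧ Crit S R A B j g e

omit hG hB hA in
theorem CPair.symm {e : G.E} {i j : Fin k} (h : CPair S R A B e i j) : CPair S R A B e j i := by
  obtain ⟨f, g, h, h1, h2⟩ := h
  exact ⟨g, f, h.symm, h2, h1⟩

omit hA in
theorem CPair.ne {e : G.E} {i j : Fin k} (h : CPair S R A B e i j) : i ≠ j := by
  rintro rfl
  obtain ⟨f, g, h, h1, h2⟩ := h
  exact h (pred_unique (path_nodup hG (hB i)) (crit_infix hB h1) (crit_infix hB h2))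

/-- `x` reaches the predecessor of `z` on `q`, and `x` lies on path `r`. -/
theorem pair_contra {z x y : G.E} {q t : Fin k} (hz : CPair S R A B z q t) (hx : x ∈ B t)
    (hxy : Relation.ReflTransGen (HH A B) x y) (hf : ∃ f, [f, z] <:+: B q ∧
      Relation.ReflTransGen (HH A B) y f) : False := by
  obtain ⟨f, hf, hyf⟩ := hf
  obtain ⟨f', g, hne, h1, h2⟩ := hz
  have : f = f' := pred_unique (path_nodup hG (hB q)) hf (crit_infix hB h1)
  subst this
  exact hne (key hG hB hA h2 hx (hxy.trans hyf) (.inr ⟨q, hf⟩))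

omit hA hG in
theorem CPair.mem1 {e : G.E} {i j : Fin k} (h : CPair S R A B e i j) : e ∈ B i := by
  obtain ⟨f, g, h, h1, h2⟩ := h
  exact crit_mem hB h1

omit hA hG in
theorem CPair.mem2 {e : G.E} {i j : Fin k} (h : CPair S R A B e i j) : e ∈ B j :=
  (CPair.symm h).mem1 hB

omit hA hG hB in
theorem B_chain (i : Fin k) : List.IsChain (HH A B) (B i) := chain_iff.2 fun _ _ h => .inr ⟨i, h⟩

theorem pair_inj {e e' : G.E} {i j : Fin k} (h : CPair S R A B e i j)
    (h' : CPair S R A B e' i j) : e = e' := by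
  by_contra hne
  rcases list_order (B_chain (A := A) i) (h.mem1 hB) (h'.mem1 hB) hne with hf | hf
  · exact pair_contra hG hB hA h' (h.mem2 hB) .refl hf
  · exact pair_contra hG hB hA h (h'.mem2 hB) .refl hf

theorem tri {x y z : G.E} {p q t : Fin k} (hx : CPair S R A B x p t) (hy : CPair S R A B y p q)
    (hz : CPair S R A B z q t) (hxy : x ≠ y) (hyz : y ≠ z) (hxz : x ≠ z) : False := by
  have st : ∀ {i : Fin k} {z f y : G.E}, [f, z] <:+: B i → Relation.ReflTransGen (HH A B) y f →
      Relation.ReflTransGen (HH A B) y z := fun h1 h2 => h2.tail (.inr ⟨_, h1⟩)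
  rcases list_order (B_chain (A := A) p) (hx.mem1 hB) (hy.mem1 hB) hxy with ⟨f, f1, f2⟩ | ⟨f, f1, f2⟩ <;>
  rcases list_order (B_chain (A := A) q) (hy.mem2 hB) (hz.mem1 hB) hyz with ⟨g, g1, g2⟩ | ⟨g, g1, g2⟩ <;>
  rcases list_order (B_chain (A := A) t) (hx.mem2 hB) (hz.mem2 hB) hxz with ⟨h, h1, h2⟩ | ⟨h, h1, h2⟩
  -- x<y<z
  · exact pair_contra hG hB hA hz (hx.mem2 hB) (st f1 f2) ⟨g, g1, g2⟩
  -- cycle x<y<z<x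
  · exact pair_contra hG hB hA hz (hx.mem2 hB) (st f1 f2) ⟨g, g1, g2⟩
  -- x<z<y
  · exact pair_contra hG hB hA hy.symm (hx.mem1 hB) (st h1 h2) ⟨g, g1, g2⟩
  -- z<x<y : y's pair p q; z on q, z->x on t, x -> y on p
  · exact pair_contra hG hB hA hy (hz.mem1 hB) (st h1 h2) ⟨f, f1, f2⟩
  -- y<x, y<z, x<z : z pair q t; y on q, y->x on p, x->z on t
  · exact pair_contra hG hB hA hz.symm (hy.mem2 hB) (st f1 f2) ⟨h, h1, h2⟩
  -- y<x, y<z, z<x : x pair p t; y on p; y->z on q; z->x on t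
  · exact pair_contra hG hB hA hx.symm (hy.mem1 hB) (st g1 g2) ⟨h, h1, h2⟩
  -- y<x,z<y,x<z cycle
  · exact pair_contra hG hB hA hz.symm (hy.mem2 hB) (st f1 f2) ⟨h, h1, h2⟩
  -- z<y<x : x pair p t; z on t; z->y on q; y->x on p
  · exact pair_contra hG hB hA hx (hz.mem2 hB) (st g1 g2) ⟨f, f1, f2⟩

omit hG hB hA in
theorem sym2_aux {κ : Type} {a b c : κ} (nab : a ≠ b) (nac : a ≠ c) (nbc : b ≠ c) :
    s(a, b) ≠ s(a, c) ∧ s(a, c) ≠ s(b, c) ∧ s(a, b) ≠ s(b, c) := by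
  simp only [ne_eq, Sym2.eq_iff]
  grind

theorem count_le (hcrit : ∀ f e, HH A B f e → ¬ HA A f e → ∃ i, Crit S R A B i f e) :
    Set.ncard {e : G.E | ∃ f g, f ≠ g ∧ HH A B f e ∧ HH A B g e} ≤ n * k + k ^ 2 / 4 := by
  classical
  have := G.fintE
  set M := {e : G.E | ∃ f g, f ≠ g ∧ HH A B f e ∧ HH A B g e} with hM
  let M1 := {e ∈ M | ∃ a, e ∈ A a}
  let M2 := {e ∈ M | ¬ ∃ a, e ∈ A a}
  have hU : M = M1 ∪ M2 := by ext e; simp only [M1, M2, Set.mem_union, Set.mem_ofPred_eq]; tauto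
  -- first part
  have h1 : ∀ e ∈ M1, ∃ x : Fin n × Fin k, e ∈ A x.1 ∧ ∃ h, Crit S R A B x.2 h e := by
    rintro e ⟨⟨f, g, hfg, hf, hg⟩, a, ha⟩
    have hu : ∀ f, HA A f e → [f, e] <:+: A a := by
      rintro f ⟨b, hb⟩
      by_cases hab : a = b
      · rw [hab]; exact hb
      · exact absurd (hb.subset (by simp)) (hA.2 a b hab e ha)
    by_cases hf' : HA A f e
    · by_cases hg' : HA A g e
      · exact absurd (pred_unique (path_nodup hG (hA.1 a)) (hu f hf') (hu g hg')) hfg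
      · obtain ⟨i, hi⟩ := hcrit g e hg hg'
        exact ⟨(a, i), ha, g, hi⟩
    · obtain ⟨i, hi⟩ := hcrit f e hf hf'
      exact ⟨(a, i), ha, f, hi⟩
  have c1 : M1.ncard ≤ n * k := by
    rcases Set.eq_empty_or_nonempty M1 with h0 | ⟨e0, he0⟩
    · rw [h0]; simp
    have hne : Nonempty _ := ⟨(h1 e0 he0).choose⟩
    choose! φ hφ using h1
    have := Set.ncard_le_ncard_of_injOn (s := M1) (t := Set.univ) φ (fun _ _ => trivial) ?_
    · simpa [Set.ncard_univ] using this
    · intro e he e' he' heq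
      obtain ⟨m, h, hc⟩ := hφ e he
      obtain ⟨m', h', hc'⟩ := hφ e' he'
      rw [← heq] at m' hc'
      exact caseA hG hB hA m m' hc hc'
  have h2 : ∀ e ∈ M2, ∃ x : Fin k × Fin k, CPair S R A B e x.1 x.2 := by
    rintro e ⟨⟨f, g, hfg, hf, hg⟩, ha⟩
    have hn : ∀ f, ¬ HA A f e := by
      rintro f ⟨a, h⟩
      exact ha ⟨a, h.subset (by simp)⟩
    obtain ⟨i, hi⟩ := hcrit f e hf (hn f)
    obtain ⟨j, hj⟩ := hcrit g e hg (hn g)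
    exact ⟨(i, j), f, g, hfg, hi, hj⟩
  have c2 : M2.ncard ≤ k ^ 2 / 4 := by
    rcases Set.eq_empty_or_nonempty M2 with h0 | ⟨e0, he0⟩
    · rw [h0]; simp
    have hne : Nonempty _ := ⟨(h2 e0 he0).choose⟩
    choose! φ hφ using h2
    let Γ : SimpleGraph (Fin k) :=
      { Adj := fun i j => ∃ e ∈ M2, s((φ e).1, (φ e).2) = s(i, j)
        symm := ⟨by
          rintro i j ⟨e, he, h⟩
          exact ⟨e, he, by rw [h, Sym2.eq_swap]⟩⟩
        loopless := ⟨by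
          rintro i ⟨e, he, h⟩
          have := (hφ e he).ne hG hB
          rw [Sym2.eq_iff] at h
          rcases h with ⟨h1, h2⟩ | ⟨h1, h2⟩ <;> exact this (h1.trans h2.symm)⟩ }
    have hadj : ∀ i j, Γ.Adj i j → ∃ e ∈ M2, s((φ e).1, (φ e).2) = s(i, j) ∧ CPair S R A B e i j := by
      rintro i j ⟨e, he, h⟩
      refine ⟨e, he, h, ?_⟩
      have := hφ e he
      rw [Sym2.eq_iff] at h
      rcases h with ⟨h1, h2⟩ | ⟨h1, h2⟩
      · rwa [h1, h2] at this
      · rw [h1, h2] at this; exact this.symm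
    have hcf : Γ.CliqueFree 3 := by
      intro s hs
      rw [SimpleGraph.is3Clique_iff] at hs
      obtain ⟨a, b, c, hab, hac, hbc, -⟩ := hs
      have nab := hab.ne
      have nac := hac.ne
      have nbc := hbc.ne
      obtain ⟨x, hx, x1, x2⟩ := hadj _ _ hab
      obtain ⟨y, hy, y1, y2⟩ := hadj _ _ hac
      obtain ⟨z, hz, z1, z2⟩ := hadj _ _ hbc
      refine tri hG hB hA (p := a) (t := b) (q := c) x2 y2 z2.symm ?_ ?_ ?_
      · rintro rfl
        rw [x1] at y1; exact (sym2_aux nab nac nbc).1 y1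
      · rintro rfl
        rw [y1] at z1; exact (sym2_aux nab nac nbc).2.1 z1
      · rintro rfl
        rw [x1] at z1; exact (sym2_aux nab nac nbc).2.2 z1
    refine le_trans ?_ (mantel k Γ hcf)
    rw [← Set.ncard_coe_finset]
    refine Set.ncard_le_ncard_of_injOn (fun e => s((φ e).1, (φ e).2)) ?_ ?_
    · intro e he
      simp only [SimpleGraph.coe_edgeFinset, SimpleGraph.mem_edgeSet]
      exact ⟨e, he, rfl⟩
    · intro e he e' he' heq
      simp only [Sym2.eq_iff] at heq
      have a1 := hφ e he
      have a2 := hφ e' he'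
      rcases heq with ⟨h1, h2⟩ | ⟨h1, h2⟩
      · rw [h1, h2] at a1
        exact pair_inj hG hB hA a1 a2
      · rw [h1, h2] at a1
        exact pair_inj hG hB hA a1.symm a2
  rw [hU]
  exact (Set.ncard_union_le _ _).trans (Nat.add_le_add c1 c2)

end Upper

theorem upper (k : ℕ) (c : Fin (k + 1) → ℕ) (hc : ∀ i : Fin k, c i.castSucc = 1) :
    MAtMost c (c (Fin.last k) * k + k ^ 2 / 4) := by
  intro G S R ⟨hG, hR, hcut⟩ hS
  have := G.fintE
  obtain ⟨⟨A, hA⟩, -⟩ := hcut (Fin.last k)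
  have hB0 : ∀ i : Fin k, ∃ p, G.IsPathFrom (S i.castSucc) (R i.castSucc) p := by
    intro i
    obtain ⟨⟨b, hb⟩, -⟩ := hcut i.castSucc
    exact ⟨b ⟨0, by rw [hc]; simp⟩, hb.1 _⟩
  obtain ⟨B, hB, hcrit⟩ := exists_min (fun i : Fin k => S i.castSucc) (fun i => R i.castSucc) A hB0
  have hcount := count_le hG hB hA hcrit
  let α : (i : Fin (k + 1)) → Fin (c i) → List G.E :=
    fun i => Fin.lastCases (motive := fun i => Fin (c i) → List G.E) A (fun i _ => B i) i
  have hl : α (Fin.last k) = A := by simp [α]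
  have hs : ∀ i : Fin k, α i.castSucc = fun _ => B i := by intro i; simp [α]
  refine ⟨α, ?_, le_trans (Set.ncard_le_ncard ?_) hcount⟩
  · intro i
    induction i using Fin.lastCases with
    | last => rw [hl]; exact hA
    | cast i =>
      rw [hs]
      refine ⟨fun _ => hB i, fun x y hxy => absurd (Fin.ext ?_) hxy⟩
      have := x.2; have := y.2; have := hc i; omega
  · rintro e ⟨i, j, -, a, b, f, g, hfg, h1, h2⟩
    have hm : ∀ (i : Fin (k + 1)) (a : Fin (c i)) (f : G.E), [f, e] <:+: α i a → HH A B f e := by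
      intro i
      induction i using Fin.lastCases with
      | last => intro a f h; rw [hl] at h; exact .inl ⟨a, h⟩
      | cast i => intro a f h; rw [hs] at h; exact .inr ⟨i, h⟩
    exact ⟨f, g, hfg, hm i a f h1, hm j b g h2⟩

section Generic

theorem rank_path (r : G.V → ℕ) (h : ∀ e, r (G.src e) < r (G.dst e)) {v : G.V} :
    ∀ {p : List G.E} {u : G.V}, G.IsPathFrom u v p → r u < r v := by
  intro p
  induction p with
  | nil => intro u hp; exact absurd rfl hp.1
  | cons e p ih =>
    intro u hp
    obtain ⟨rfl, ⟨-, rfl⟩ | hq⟩ := path_tail hp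
    · exact h e
    · exact (h e).trans (ih hq)

theorem pot_path (φ : G.V → ℤ) {v : G.V} :
    ∀ {p : List G.E} {u : G.V}, G.IsPathFrom u v p →
      (p.map (fun e => φ (G.dst e) - φ (G.src e))).sum = φ v - φ u := by
  intro p
  induction p with
  | nil => intro u hp; exact absurd rfl hp.1
  | cons e p ih =>
    intro u hp
    obtain ⟨rfl, ⟨rfl, rfl⟩ | hq⟩ := path_tail hp
    · simp
    · rw [List.map_cons, List.sum_cons, ih hq]; ring

theorem cut_path (Z : G.V → Prop) (e : G.E) (h : ∀ f, f ≠ e → Z (G.src f) → Z (G.dst f)) {v : G.V}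
    (hv : ¬ Z v) : ∀ {p : List G.E} {u : G.V}, G.IsPathFrom u v p → Z u → e ∈ p := by
  intro p
  induction p with
  | nil => intro u hp; exact absurd rfl hp.1
  | cons f p ih =>
    intro u hp hu
    by_cases hfe : f = e
    · simp [hfe]
    obtain ⟨rfl, ⟨rfl, rfl⟩ | hq⟩ := path_tail hp
    · exact absurd (h f hfe hu) hv
    · exact List.mem_cons_of_mem _ (ih hq (h f hfe hu))

theorem next_edge {v : G.V} {f : G.E} (hf : G.dst f ≠ v) :
    ∀ {p : List G.E} {u : G.V}, G.IsPathFrom u v p → f ∈ p →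
      ∃ g, G.src g = G.dst f ∧ [f, g] <:+: p := by
  intro p
  induction p with
  | nil => intro u hp; exact absurd rfl hp.1
  | cons e p ih =>
    intro u hp hm
    obtain ⟨rfl, ⟨rfl, rfl⟩ | hq⟩ := path_tail hp
    · simp at hm; subst hm; exact absurd rfl hf
    · rcases List.mem_cons.1 hm with rfl | hm
      · cases p with
        | nil => exact absurd rfl hq.1
        | cons g p =>
          refine ⟨g, (path_tail hq).1, ⟨[], p, by simp⟩⟩
      · obtain ⟨g, h1, h2⟩ := ih hq hm
        exact ⟨g, h1, h2.trans (List.suffix_cons _ _).isInfix⟩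

theorem build_path (r : G.V → ℕ) (hr : ∀ e, r (G.src e) < r (G.dst e)) (u : G.V) (F : G.E → Prop)
    (hF : ∀ f, F f → G.src f = u ∨ ∃ e, F e ∧ G.dst e = G.src f) :
    ∀ N f, r (G.src f) ≤ N → F f → ∃ p, G.IsPathFrom u (G.dst f) p := by
  intro N
  induction N with
  | zero =>
    intro f hf hFf
    rcases hF f hFf with h | ⟨e, he, h⟩
    · exact ⟨[f], h ▸ path_single f⟩
    · have := hr e; rw [h] at this; omega
  | succ N ih =>
    intro f hf hFf
    rcases hF f hFf with h | ⟨e, he, h⟩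
    · exact ⟨[f], h ▸ path_single f⟩
    · have := hr e
      rw [h] at this
      obtain ⟨p, hp⟩ := ih e (by omega) he
      rw [h] at hp
      exact ⟨p ++ [f], path_append hp (path_single f)⟩

theorem pigeon {u v : G.V} {c : ℕ} (g : G.E → ℕ) (h1 : ∀ e, G.src e = u → g e < c)
    (h2 : ∀ e e', G.src e = u → G.src e' = u → g e = g e' → e = e') :
    ¬ ∃ α : Fin (c + 1) → List G.E, G.MengerSystem u v (c + 1) α := by
  rintro ⟨α, hα, hd⟩
  have : ∀ i, ∃ e, e ∈ α i ∧ G.src e = u := by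
    intro i
    have := hα i
    cases h : α i with
    | nil => exact absurd h this.1
    | cons e p => rw [h] at this; exact ⟨e, by simp, (path_tail this).1⟩
  choose e he hu using this
  obtain ⟨x, y, hxy, h⟩ := Fintype.exists_ne_map_eq_of_card_lt
    (fun i => (⟨g (e i), h1 _ (hu i)⟩ : Fin c)) (by simp)
  simp only [Fin.mk.injEq] at h
  have := h2 _ _ (hu x) (hu y) h
  exact hd x y hxy (e x) (he x) (this ▸ he y)

open Classical in
theorem sum_system (hG : G.Acyclic) (φ : G.V → ℤ) {u v : G.V} {c : ℕ} {α : Fin c → List G.E}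
    (hα : G.MengerSystem u v c α) :
    ∑ e ∈ Finset.univ.biUnion (fun i => (α i).toFinset), (φ (G.dst e) - φ (G.src e))
      = c * (φ v - φ u) := by
  rw [Finset.sum_biUnion]
  · have : ∀ i ∈ Finset.univ, ∑ e ∈ (α i).toFinset, (φ (G.dst e) - φ (G.src e)) = φ v - φ u := by
      intro i _
      rw [List.sum_toFinset _ (path_nodup hG (hα.1 i))]
      exact pot_path φ (hα.1 i)
    rw [Finset.sum_congr rfl this]
    simp only [Finset.sum_const, Finset.card_univ, Fintype.card_fin, nsmul_eq_mul]
  · intro i _ j _ hij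
    rw [Function.onFun, Finset.disjoint_left]
    intro e he he'
    exact hα.2 i j hij e (by simpa using he) (by simpa using he')

theorem all_used (hG : G.Acyclic) (φ : G.V → ℤ) {u v : G.V} {c : ℕ} {α α' : Fin c → List G.E}
    (hα : G.MengerSystem u v c α) (hα' : G.MengerSystem u v c α')
    (h1 : ∀ i, ∀ e ∈ α i, φ (G.dst e) < φ (G.src e))
    (h2 : ∀ e, (∀ i, e ∉ α i) → φ (G.src e) ≤ φ (G.dst e)) {e : G.E} {i : Fin c} (he : e ∈ α i) :
    ∃ j, e ∈ α' j := by
  classical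
  by_contra hcon
  push Not at hcon
  have s1 := sum_system hG φ hα
  have s2 := sum_system hG φ hα'
  set U := Finset.univ.biUnion (fun i => (α i).toFinset) with hU
  set U' := Finset.univ.biUnion (fun i => (α' i).toFinset) with hU'
  have mU : ∀ e, e ∈ U ↔ ∃ i, e ∈ α i := by simp [U]
  have mU' : ∀ e, e ∈ U' ↔ ∃ i, e ∈ α' i := by simp [U']
  have a1 : ∑ e ∈ U' ∩ U, (φ (G.dst e) - φ (G.src e)) ≤ ∑ e ∈ U', (φ (G.dst e) - φ (G.src e)) := by
    refine Finset.sum_le_sum_of_subset_of_nonneg Finset.inter_subset_left ?_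
    intro e he hn
    have := h2 e (fun i hi => hn (Finset.mem_inter.2 ⟨he, (mU e).2 ⟨i, hi⟩⟩))
    linarith
  have a2 : ∑ e ∈ U' ∩ U, -(φ (G.dst e) - φ (G.src e)) < ∑ e ∈ U, -(φ (G.dst e) - φ (G.src e)) := by
    refine Finset.sum_lt_sum_of_subset Finset.inter_subset_right ((mU e).2 ⟨i, he⟩) ?_ ?_ ?_
    · intro h
      obtain ⟨j, hj⟩ := (mU' e).1 (Finset.mem_inter.1 h).1
      exact hcon j hj
    · have := h1 i e he; linarith
    · intro e he hn
      obtain ⟨j, hj⟩ := (mU e).1 he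
      have := h1 j e hj; linarith
  simp only [Finset.sum_neg_distrib] at a2
  linarith

end Generic

inductive RV : Type
  | mi (i a : ℕ) : RV
  | mo (i a : ℕ) : RV
  | ei (x y : ℕ) : RV
  | eo (x y : ℕ) : RV
  | S (i : ℕ) : RV
  | R (i : ℕ) : RV

inductive RE : Type
  | m (i a : ℕ) : RE
  | la (i a : ℕ) : RE
  | lb (i a : ℕ) : RE
  | e (x y : ℕ) : RE
  | lx (x y : ℕ) : RE
  | ly (x y : ℕ) : RE
  | lr (i : ℕ) : RE

structure Par where
  k : ℕ
  n : ℕ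
  s : ℕ
  t : ℕ
  hst : s ≤ t
  htk : t ≤ k
  hk : 0 < k
  hn : 0 < n
  htn : t ≤ n
  hks : k ≤ n + s

namespace Par

variable (P : Par)

/-- Valid cross nodes. -/
def cross (x y : ℕ) : Prop :=
  (x < P.s ∧ P.s ≤ y ∧ y < P.t) ∨ (P.s ≤ x ∧ x < P.t ∧ P.t ≤ y ∧ y < P.k)

def lo (i : ℕ) : ℕ := if i < P.t then 0 else P.s
def le (i : ℕ) : ℕ := if i < P.s then 0 else if i < P.t then P.s else P.t
def us (i : ℕ) : ℕ := if i < P.s then P.s else if i < P.t then P.t else P.k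
def ue (i : ℕ) : ℕ := if i < P.s then P.t else P.k

def valid : RE → Prop
  | .m i a => i < P.k ∧ a < P.n
  | .la i a => i ≤ P.k ∧ a < P.n
  | .lb i a => i < P.k ∧ a < P.n
  | .e x y => P.cross x y
  | .lx x y => P.cross x y
  | .ly x y => P.cross x y
  | .lr i => i < P.k

def src : RE → RV
  | .m i a => .mi i a
  | .la i a => if i = 0 then .S P.k else .mo (i - 1) a
  | .lb i a => if 0 < a then .mo i (a - 1) else if P.lo i < P.le i then .eo (P.le i - 1) i else .S i
  | .e x y => .ei x y
  | .lx x y => if y = P.us x then .mo x (P.n - 1) else .eo x (y - 1)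
  | .ly x y => if x = P.lo y then .S y else .eo (x - 1) y
  | .lr i => if P.us i < P.ue i then .eo i (P.ue i - 1) else .mo i (P.n - 1)

def dst : RE → RV
  | .m i a => .mo i a
  | .la i a => if i = P.k then .R P.k else .mi i a
  | .lb i a => .mi i a
  | .e x y => .eo x y
  | .lx x y => .ei x y
  | .ly x y => .ei x y
  | .lr i => .R i

def base (i : ℕ) : ℕ :=
  if i < P.s then 0 else if i < P.t then 8 * (P.n + 2 * P.k + 2) else 16 * (P.n + 2 * P.k + 2)

def gbase (x : ℕ) : ℕ :=
  if x < P.s then 4 * (P.n + 2 * P.k + 2) else 12 * (P.n + 2 * P.k + 2)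

def rank : RV → ℕ
  | .mi i a => P.base i + 2 * (i + a) + 1
  | .mo i a => P.base i + 2 * (i + a) + 2
  | .ei x y => P.gbase x + 2 * (x + y) + 1
  | .eo x y => P.gbase x + 2 * (x + y) + 2
  | .S _ => 0
  | .R _ => 100 * (P.n + 2 * P.k + 2)

theorem rank_lt (e : RE) (he : P.valid e) : P.rank (P.src e) < P.rank (P.dst e) := by
  obtain ⟨k, n, s, t, hst, htk, hk, hn, htn, hks⟩ := P
  cases e <;> simp only [valid, cross, src, dst, lo, le, us, ue] at he ⊢ <;>
    (try split_ifs) <;> simp only [rank, base, gbase] <;> (try split_ifs) <;> omega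

def pot : RV → ℤ
  | .mi i a => -((P.n + 1) * i) - P.n * a
  | .mo i a => -((P.n + 1) * i) - P.n * (a + 1)
  | .ei x _ => if x < P.s then -(P.n * P.n) else -((P.n + 1) * P.s) - P.n * P.n
  | .eo x _ => if x < P.s then -(P.n * P.n) else -((P.n + 1) * P.s) - P.n * P.n
  | .S i => if i = P.k then 1 else -((P.n + 1) * P.k) - P.n * P.n - P.n - 1
  | .R i => if i = P.k then -((P.n + 1) * P.k) - P.n * P.n - P.n - 1 else 1

def isA : RE → Prop
  | .m _ _ => True
  | .la _ _ => True
  | _ => False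

theorem pot_lt (e : RE) (he : P.valid e) (h : isA e) : P.pot (P.dst e) < P.pot (P.src e) := by
  obtain ⟨k, n, s, t, hst, htk, hk, hn, htn, hks⟩ := P
  cases e with
  | m i a => simp only [src, dst, pot]; push_cast; nlinarith
  | la i a =>
    simp only [valid] at he
    simp only [src, dst]
    rcases i with _ | i
    · rw [if_pos rfl, if_neg (by omega)]
      simp only [pot, if_true]; push_cast; nlinarith
    · rw [if_neg (show ¬ i + 1 = 0 by omega), Nat.add_sub_cancel]
      split_ifs with h1
      · simp only [pot, if_true]
        have h3 : (k : ℤ) = i + 1 := by omega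
        have h4 : (a : ℤ) + 1 ≤ n := by omega
        rw [h3]; nlinarith
      · simp only [pot]; push_cast; nlinarith
  | _ => simp [isA] at h

theorem pot_le (e : RE) (he : P.valid e) (h : ¬ isA e) : P.pot (P.src e) ≤ P.pot (P.dst e) := by
  obtain ⟨k, n, s, t, hst, htk, hk, hn, htn, hks⟩ := P
  have aux : ∀ {x y z : ℕ}, x ≤ y → z * x ≤ z * y := fun h => Nat.mul_le_mul_left _ h
  cases e with
  | m i a => simp [isA] at h
  | la i a => simp [isA] at h
  | lb i a =>
    obtain ⟨h1, h2⟩ := he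
    simp only at h1 h2
    simp only [src, dst]
    rcases a with _ | a
    · rw [if_neg (by omega)]
      by_cases h3 : i < s
      · have : ¬ ((Par.mk k n s t hst htk hk hn htn hks).lo i < (Par.mk k n s t hst htk hk hn htn hks).le i) := by
          simp only [lo, le]; split_ifs <;> omega
        rw [if_neg this]
        simp only [pot]; rw [if_neg (by omega)]
        zify at *; push_cast; nlinarith
      · split_ifs with h4
        · simp only [lo, le] at h4 ⊢
          simp only [pot]
          split_ifs at h4 ⊢ <;> first | omega | (zify at *; nlinarith)
        · simp only [pot]; rw [if_neg (by omega)]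
          zify at *; push_cast; nlinarith
    · simp [pot]
  | e x y => simp [src, dst, pot]
  | lx x y =>
    simp only [valid, cross] at he
    simp only [src, dst, us]
    by_cases hx : x < s
    · simp only [hx, if_true]
      split_ifs
      · simp only [pot, hx, if_true]
        have : ((n - 1 : ℕ) : ℤ) = n - 1 := by omega
        rw [this]; nlinarith
      · simp [pot]
    · have hx' : x < t := by omega
      simp only [hx, hx', if_true, if_false]
      split_ifs
      · simp only [pot, hx, if_false]
        have : ((n - 1 : ℕ) : ℤ) = n - 1 := by omega
        rw [this]
        push Not at hx
        zify at *; nlinarith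
      · simp [pot]
  | ly x y =>
    simp only [valid, cross] at he
    simp only [src, dst, lo]
    have hy : y ≠ k := by omega
    have hsk : (n + 1) * s ≤ (n + 1) * k := aux (by omega)
    zify at hsk
    split_ifs <;> simp only [pot, hy, if_false] <;> split_ifs <;> first | omega | nlinarith
  | lr i =>
    simp only [valid] at he
    simp only [src, dst]
    split_ifs
    · simp only [pot]; rw [if_neg (show i ≠ k by omega)]; split_ifs <;> zify at * <;> nlinarith
    · simp only [pot]; rw [if_neg (show i ≠ k by omega)]; zify at * ; nlinarith

end Par

namespace Par

variable (P : Par)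

def Wx (i x y : ℕ) : Prop := i < x ∨ (i < y ∧ ((P.s ≤ i ∧ x < P.s) ∨ P.t ≤ i))

def Zb (i a : ℕ) : RV → Prop
  | .mi x b => i < x ∨ (x = i ∧ b < a)
  | .mo x b => i < x ∨ (x = i ∧ b < a)
  | .ei x y => P.Wx i x y ∨ y = i
  | .eo x y => P.Wx i x y ∨ y = i
  | .S j => j = i
  | .R j => j ≠ i

def Zx (i y0 : ℕ) : RV → Prop
  | .mi x _ => i ≤ x
  | .mo x _ => i ≤ x
  | .ei x y => P.Wx i x y ∨ y = i ∨ (x = i ∧ y < y0)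
  | .eo x y => P.Wx i x y ∨ y = i ∨ (x = i ∧ y < y0)
  | .S j => j = i
  | .R j => j ≠ i

def Zy (i x0 : ℕ) : RV → Prop
  | .mi x _ => i < x
  | .mo x _ => i < x
  | .ei x y => P.Wx i x y ∨ (y = i ∧ x < x0)
  | .eo x y => P.Wx i x y ∨ (y = i ∧ x < x0)
  | .S j => j = i
  | .R j => j ≠ i

theorem cut_b (i a : ℕ) (hv : P.valid (.lb i a)) (f : RE) (hf : P.valid f) (hne : f ≠ .lb i a)
    (h : P.Zb i a (P.src f)) : P.Zb i a (P.dst f) := by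
  obtain ⟨k, n, s, t, hst, htk, hk, hn, htn, hks⟩ := P
  cases f <;> simp only [valid, cross, src, dst, lo, le, us, ue, ne_eq, RE.lb.injEq] at hf hne h hv ⊢ <;>
    (try split_ifs at h ⊢) <;> simp only [Zb, Wx] at h ⊢ <;> omega

theorem cut_x (i y : ℕ) (hv : P.valid (.lx i y)) (f : RE) (hf : P.valid f) (hne : f ≠ .lx i y)
    (h : P.Zx i y (P.src f)) : P.Zx i y (P.dst f) := by
  obtain ⟨k, n, s, t, hst, htk, hk, hn, htn, hks⟩ := P
  cases f <;> simp only [valid, cross, src, dst, lo, le, us, ue, ne_eq, RE.lx.injEq] at hf hne h hv ⊢ <;>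
    (try split_ifs at h ⊢) <;> simp only [Zx, Wx] at h ⊢ <;> omega

theorem cut_y (i x : ℕ) (hv : P.valid (.ly x i)) (f : RE) (hf : P.valid f) (hne : f ≠ .ly x i)
    (h : P.Zy i x (P.src f)) : P.Zy i x (P.dst f) := by
  obtain ⟨k, n, s, t, hst, htk, hk, hn, htn, hks⟩ := P
  cases f <;> simp only [valid, cross, src, dst, lo, le, us, ue, ne_eq, RE.ly.injEq] at hf hne h hv ⊢ <;>
    (try split_ifs at h ⊢) <;> simp only [Zy, Wx] at h ⊢ <;> omega

/-- Edges of the `i`-th line. -/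
def line (i : ℕ) : RE → Prop
  | .m j _ => j = i
  | .la _ _ => False
  | .lb j _ => j = i
  | .e x y => x = i ∨ y = i
  | .lx x _ => x = i
  | .ly _ y => y = i
  | .lr j => j = i

theorem line_back (i : ℕ) (f : RE) (hf : P.valid f) (hl : line i f) :
    P.src f = .S i ∨ ∃ e, P.valid e ∧ line i e ∧ P.dst e = P.src f := by
  have h1 := P.hst
  have h2 := P.htk
  have h3 := P.hn
  cases f with
  | m j a => exact .inr ⟨.lb j a, hf, hl, rfl⟩
  | la j a => exact hl.elim
  | lb j a =>
    simp only [valid, line] at hf hl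
    subst hl
    simp only [src]
    split_ifs with h4 h5
    · exact .inr ⟨.m j (a - 1), by simp only [valid]; omega, rfl, rfl⟩
    · refine .inr ⟨.e (P.le j - 1) j, ?_, .inr rfl, rfl⟩
      simp only [valid, cross, lo, le] at h5 ⊢
      split_ifs at h5 ⊢ <;> omega
    · exact .inl rfl
  | e x y =>
    rcases hl with rfl | rfl
    · exact .inr ⟨.lx x y, hf, rfl, rfl⟩
    · exact .inr ⟨.ly x y, hf, rfl, rfl⟩
  | lx x y =>
    simp only [valid, cross, line] at hf hl
    subst hl
    simp only [src]
    split_ifs with h4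
    · exact .inr ⟨.m x (P.n - 1), by simp only [valid]; omega, rfl, rfl⟩
    · refine .inr ⟨.e x (y - 1), ?_, .inl rfl, rfl⟩
      simp only [valid, cross, us] at h4 ⊢
      split_ifs at h4 <;> omega
  | ly x y =>
    simp only [valid, cross, line] at hf hl
    subst hl
    simp only [src]
    split_ifs with h4
    · exact .inl rfl
    · refine .inr ⟨.e (x - 1) y, ?_, .inr rfl, rfl⟩
      simp only [valid, cross, lo] at h4 ⊢
      split_ifs at h4 <;> omega
  | lr j =>
    simp only [valid, line] at hf hl
    subst hl
    simp only [src]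
    split_ifs with h4
    · refine .inr ⟨.e j (P.ue j - 1), ?_, .inl rfl, rfl⟩
      simp only [valid, cross, us, ue] at h4 ⊢
      split_ifs at h4 ⊢ <;> omega
    · exact .inr ⟨.m j (P.n - 1), by simp only [valid]; omega, rfl, rfl⟩

theorem out_mi (i a : ℕ) (f : RE) (h : P.src f = .mi i a) : f = .m i a := by
  cases f <;> simp only [src] at h <;> (try split_ifs at h) <;> simp_all

theorem out_ei (x y : ℕ) (f : RE) (h : P.src f = .ei x y) : f = .e x y := by
  cases f <;> simp only [src] at h <;> (try split_ifs at h) <;> simp_all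

theorem out_S (i : ℕ) (hi : i < P.k) (f g : RE) (vf : P.valid f) (vg : P.valid g)
    (h : P.src f = .S i) (h' : P.src g = .S i) : f = g := by
  have key : ∀ f, P.valid f → P.src f = .S i →
      (P.lo i < P.le i ∧ f = .ly (P.lo i) i) ∨ (¬ P.lo i < P.le i ∧ f = .lb i 0) := by
    intro f vf h
    have h1 := P.hst
    cases f <;> simp only [src] at h <;> (try split_ifs at h) <;> 
      simp only [RV.S.injEq, reduceCtorEq] at h
    · omega
    · subst h; right; rename_i h5 h6; exact ⟨h6, by congr 1; omega⟩
    · subst h; left; rename_i x y h5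
      refine ⟨?_, by rw [h5]⟩
      simp only [valid, cross] at vf
      rw [← h5]
      simp only [le]; split_ifs <;> omega
  rcases key f vf h with ⟨a, b⟩ | ⟨a, b⟩ <;> rcases key g vg h' with ⟨c, d⟩ | ⟨c, d⟩
  · rw [b, d]
  · exact absurd a c
  · exact absurd c a
  · rw [b, d]

theorem out_Sk (f : RE) (vf : P.valid f) (h : P.src f = .S P.k) : ∃ a < P.n, f = .la 0 a := by
  have h2 := P.htk
  cases f <;> simp only [src] at h <;> (try split_ifs at h) <;> 
    simp only [RV.S.injEq, reduceCtorEq] at h <;> simp only [valid, cross] at vf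
  · rename_i i a h0; subst h0; exact ⟨a, vf.2, rfl⟩
  · omega
  · omega

theorem valid_finite : {e | P.valid e}.Finite := by
  let f : RE → ℕ × ℕ × ℕ := fun e => match e with
    | .m i a => (0, i, a)
    | .la i a => (1, i, a)
    | .lb i a => (2, i, a)
    | .e i a => (3, i, a)
    | .lx i a => (4, i, a)
    | .ly i a => (5, i, a)
    | .lr i => (6, i, 0)
  have hf : Function.Injective f := by
    intro x y h
    cases x <;> cases y <;> simp_all [f]
  refine (((Set.finite_Iio 7).prod ((Set.finite_Iic (P.n + P.k)).prod
    (Set.finite_Iic (P.n + P.k)))).preimage (hf.injOn)).subset ?_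
  intro e he
  have h1 := P.hst
  have h2 := P.htk
  cases e <;> simp only [Set.mem_ofPred_eq, valid, cross] at he <;>
    simp only [f, Set.mem_preimage, Set.mem_prod, Set.mem_Iio, Set.mem_Iic] <;> omega

end Par

namespace Par

variable (P : Par)

noncomputable abbrev graph : MultiDigraph where
  V := {v : RV // ∃ e, P.valid e ∧ (P.src e = v ∨ P.dst e = v)}
  E := {e : RE // P.valid e}
  fintV := by
    have : {v : RV | ∃ e, P.valid e ∧ (P.src e = v ∨ P.dst e = v)}.Finite := by
      refine ((P.valid_finite.image P.src).union (P.valid_finite.image P.dst)).subset ?_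
      rintro v ⟨e, he, h | h⟩
      · exact .inl ⟨e, he, h⟩
      · exact .inr ⟨e, he, h⟩
    exact this.fintype
  fintE := P.valid_finite.fintype
  src := fun e => ⟨P.src e.1, e.1, e.2, .inl rfl⟩
  dst := fun e => ⟨P.dst e.1, e.1, e.2, .inr rfl⟩

theorem exS (i : ℕ) (hi : i ≤ P.k) : ∃ e, P.valid e ∧ P.src e = .S i := by
  have h1 := P.hst
  have h2 := P.hk
  have h3 := P.hn
  rcases Nat.lt_or_eq_of_le hi with hi | rfl
  · by_cases h : P.lo i < P.le i
    · refine ⟨.ly (P.lo i) i, ?_, by simp [src]⟩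
      simp only [valid, cross, lo, le] at h ⊢
      split_ifs at h ⊢ <;> omega
    · exact ⟨.lb i 0, ⟨hi, h3⟩, by simp [src, h]⟩
  · exact ⟨.la 0 0, ⟨by omega, h3⟩, by simp [src]⟩

theorem exR (i : ℕ) (hi : i ≤ P.k) : ∃ e, P.valid e ∧ P.dst e = .R i := by
  have h3 := P.hn
  rcases Nat.lt_or_eq_of_le hi with hi | rfl
  · exact ⟨.lr i, hi, rfl⟩
  · exact ⟨.la P.k 0, ⟨le_rfl, h3⟩, by simp [dst]⟩

def vS (i : ℕ) (hi : i ≤ P.k) : P.graph.V :=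
  ⟨.S i, (P.exS i hi).imp fun _ h => ⟨h.1, .inl h.2⟩⟩

def vR (i : ℕ) (hi : i ≤ P.k) : P.graph.V :=
  ⟨.R i, (P.exR i hi).imp fun _ h => ⟨h.1, .inr h.2⟩⟩

theorem g_rank (e : P.graph.E) : P.rank (P.graph.src e).1 < P.rank (P.graph.dst e).1 :=
  P.rank_lt e.1 e.2

theorem acyclic : P.graph.Acyclic := by
  intro v p hp
  exact lt_irrefl _ (rank_path (G := P.graph) (fun v => P.rank v.1) P.g_rank hp)

theorem beta (i : ℕ) (hi : i < P.k) : ∃ p, P.graph.IsPathFrom (P.vS i hi.le) (P.vR i hi.le) p := by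
  refine build_path (G := P.graph) (fun v => P.rank v.1) P.g_rank (P.vS i hi.le)
    (fun f => line i f.1) ?_ _ ⟨.lr i, hi⟩ le_rfl rfl
  rintro ⟨f, vf⟩ hf
  rcases P.line_back i f vf hf with h | ⟨e, ve, hl, h⟩
  · exact .inl (Subtype.ext h)
  · exact .inr ⟨⟨e, ve⟩, hl, Subtype.ext h⟩

theorem alpha_aux (a : ℕ) (ha : a < P.n) : ∀ (i : ℕ) (hi : i ≤ P.k), ∃ p,
    P.graph.IsPathFrom (P.vS P.k le_rfl) (P.graph.dst ⟨.la i a, ⟨hi, ha⟩⟩) p ∧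
    ∀ e : P.graph.E, e ∈ p ↔ (∃ j ≤ i, e.1 = .la j a) ∨ (∃ j < i, e.1 = .m j a) := by
  intro i
  induction i with
  | zero =>
    intro hi
    refine ⟨[⟨.la 0 a, ⟨hi, ha⟩⟩], path_single (G := P.graph) ⟨.la 0 a, ⟨hi, ha⟩⟩, ?_⟩
    rintro ⟨e, he⟩
    rw [List.mem_singleton]
    simp [Subtype.ext_iff]
  | succ i ih =>
    intro hi
    obtain ⟨p, hp, hm⟩ := ih (by omega)
    have e1 : P.valid (.m i a) := ⟨by omega, ha⟩
    have e2 : P.valid (.la (i + 1) a) := ⟨hi, ha⟩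
    have p1 := path_single (G := P.graph) ⟨.m i a, e1⟩
    have p2 := path_single (G := P.graph) ⟨.la (i + 1) a, e2⟩
    have q1 : P.graph.dst ⟨.la i a, ⟨by omega, ha⟩⟩ = P.graph.src ⟨.m i a, e1⟩ := by
      apply Subtype.ext
      simp only [graph, src, dst]
      rw [if_neg (by omega)]
    have q2 : P.graph.dst ⟨.m i a, e1⟩ = P.graph.src ⟨.la (i + 1) a, e2⟩ := by
      apply Subtype.ext
      simp [graph, src, dst]
    rw [q1] at hp
    rw [q2] at p1
    refine ⟨_, path_append (path_append hp p1) p2, ?_⟩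
    rintro ⟨e, he⟩
    rw [List.mem_append, List.mem_append, hm, List.mem_singleton, List.mem_singleton,
      Subtype.ext_iff, Subtype.ext_iff]
    simp only
    constructor
    · rintro (((⟨j, hj, h⟩ | ⟨j, hj, h⟩) | h) | h)
      · exact .inl ⟨j, by omega, h⟩
      · exact .inr ⟨j, by omega, h⟩
      · exact .inr ⟨i, by omega, h⟩
      · exact .inl ⟨i + 1, le_rfl, h⟩
    · rintro (⟨j, hj, h⟩ | ⟨j, hj, h⟩)
      · rcases Nat.lt_or_eq_of_le hj with hj | rfl
        · exact .inl (.inl (.inl ⟨j, by omega, h⟩))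
        · exact .inr h
      · rcases Nat.lt_or_eq_of_le (Nat.le_of_lt_succ hj) with hj | rfl
        · exact .inl (.inl (.inr ⟨j, by omega, h⟩))
        · exact .inl (.inr h)

theorem alpha : ∃ α : Fin P.n → List P.graph.E,
    P.graph.MengerSystem (P.vS P.k le_rfl) (P.vR P.k le_rfl) P.n α ∧
    (∀ e : P.graph.E, (∃ a, e ∈ α a) ↔ isA e.1) := by
  have := fun a : Fin P.n => P.alpha_aux a a.2 P.k le_rfl
  choose α h1 h2 using this
  refine ⟨α, ⟨fun a => ?_, ?_⟩, ?_⟩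
  · have := h1 a
    have h : P.graph.dst ⟨.la P.k a, ⟨le_rfl, a.2⟩⟩ = P.vR P.k le_rfl := by
      apply Subtype.ext
      simp [graph, dst, vR]
    rwa [h] at this
  · rintro a b hab e he he'
    rw [h2] at he he'
    apply hab
    rcases he with ⟨j, -, h⟩ | ⟨j, -, h⟩ <;> rcases he' with ⟨j', -, h'⟩ | ⟨j', -, h'⟩ <;>
      rw [h] at h' <;> simp at h'
    · exact Fin.ext h'.2
    · exact Fin.ext h'.2
  · rintro ⟨e, he⟩
    simp only [h2]
    constructor
    · rintro ⟨a, ⟨j, -, rfl⟩ | ⟨j, -, rfl⟩⟩ <;> trivial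
    · intro h
      cases e with
      | m i a => exact ⟨⟨a, he.2⟩, .inr ⟨i, he.1, rfl⟩⟩
      | la i a => exact ⟨⟨a, he.2⟩, .inl ⟨i, he.1, rfl⟩⟩
      | _ => exact h.elim

theorem cutS (i : ℕ) (hi : i < P.k) (v : P.graph.V) :
    ¬ ∃ α : Fin (1 + 1) → List P.graph.E, P.graph.MengerSystem (P.vS i hi.le) v (1 + 1) α := by
  refine pigeon (fun _ => 0) (fun _ _ => by omega) ?_
  rintro ⟨e, he⟩ ⟨f, hf⟩ h h' -
  exact Subtype.ext (P.out_S i hi e f he hf (congrArg Subtype.val h) (congrArg Subtype.val h'))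

theorem cutSk (v : P.graph.V) : ¬ ∃ α : Fin (P.n + 1) → List P.graph.E,
    P.graph.MengerSystem (P.vS P.k le_rfl) v (P.n + 1) α := by
  let g : P.graph.E → ℕ := fun e => match e.1 with
    | .la _ a => a
    | _ => 0
  refine pigeon g ?_ ?_
  · rintro ⟨e, he⟩ h
    obtain ⟨a, ha, rfl⟩ := P.out_Sk e he (congrArg Subtype.val h)
    exact ha
  · rintro ⟨e, he⟩ ⟨f, hf⟩ h h' hg
    obtain ⟨a, ha, rfl⟩ := P.out_Sk e he (congrArg Subtype.val h)
    obtain ⟨b, hb, rfl⟩ := P.out_Sk f hf (congrArg Subtype.val h')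
    have : a = b := hg
    subst this
    rfl

theorem merge_next {f e : P.graph.E} {p : List P.graph.E} {u v : P.graph.V}
    (hp : P.graph.IsPathFrom u v p) (hf : f ∈ p) (h1 : P.graph.dst f ≠ v)
    (h2 : ∀ g : RE, P.src g = P.dst f.1 → g = e.1) : [f, e] <:+: p := by
  obtain ⟨g, h3, h4⟩ := next_edge h1 hp hf
  have : g = e := Subtype.ext (h2 g.1 (congrArg Subtype.val h3))
  rwa [this] at h4

theorem use_b {i a : ℕ} (hv : P.valid (.lb i a)) (hi : i < P.k) {p : List P.graph.E}
    (hp : P.graph.IsPathFrom (P.vS i hi.le) (P.vR i hi.le) p) :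
    [(⟨.lb i a, hv⟩ : P.graph.E), ⟨.m i a, hv⟩] <:+: p := by
  refine P.merge_next hp ?_ ?_ ?_
  · refine cut_path (G := P.graph) (fun v => P.Zb i a v.1) ⟨.lb i a, hv⟩ ?_ ?_ hp ?_
    · rintro ⟨f, vf⟩ hne h
      exact P.cut_b i a hv f vf (fun h => hne (Subtype.ext h)) h
    · simp [vR, Zb]
    · simp [vS, Zb]
  · intro h
    have := congrArg Subtype.val h
    simp [graph, vR, dst] at this
  · intro g hg
    exact P.out_mi i a g hg

theorem use_x {i y : ℕ} (hv : P.valid (.lx i y)) (hi : i < P.k) {p : List P.graph.E}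
    (hp : P.graph.IsPathFrom (P.vS i hi.le) (P.vR i hi.le) p) :
    [(⟨.lx i y, hv⟩ : P.graph.E), ⟨.e i y, hv⟩] <:+: p := by
  refine P.merge_next hp ?_ ?_ ?_
  · refine cut_path (G := P.graph) (fun v => P.Zx i y v.1) ⟨.lx i y, hv⟩ ?_ ?_ hp ?_
    · rintro ⟨f, vf⟩ hne h
      exact P.cut_x i y hv f vf (fun h => hne (Subtype.ext h)) h
    · simp [vR, Zx]
    · simp [vS, Zx]
  · intro h
    have := congrArg Subtype.val h
    simp [graph, vR, dst] at this
  · intro g hg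
    exact P.out_ei i y g hg

theorem use_y {i x : ℕ} (hv : P.valid (.ly x i)) (hi : i < P.k) {p : List P.graph.E}
    (hp : P.graph.IsPathFrom (P.vS i hi.le) (P.vR i hi.le) p) :
    [(⟨.ly x i, hv⟩ : P.graph.E), ⟨.e x i, hv⟩] <:+: p := by
  refine P.merge_next hp ?_ ?_ ?_
  · refine cut_path (G := P.graph) (fun v => P.Zy i x v.1) ⟨.ly x i, hv⟩ ?_ ?_ hp ?_
    · rintro ⟨f, vf⟩ hne h
      exact P.cut_y i x hv f vf (fun h => hne (Subtype.ext h)) h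
    · simp [vR, Zy]
    · simp [vS, Zy]
  · intro h
    have := congrArg Subtype.val h
    simp [graph, vR, dst] at this
  · intro g hg
    exact P.out_ei x i g hg

theorem use_a {i a : ℕ} (hv : P.valid (.m i a)) {α : Fin P.n → List P.graph.E}
    (hα : P.graph.MengerSystem (P.vS P.k le_rfl) (P.vR P.k le_rfl) P.n α) :
    ∃ b, [(⟨.la i a, ⟨hv.1.le, hv.2⟩⟩ : P.graph.E), ⟨.m i a, hv⟩] <:+: α b := by
  obtain ⟨α0, h0, hA⟩ := P.alpha
  obtain ⟨b0, hb0⟩ := (hA ⟨.la i a, ⟨hv.1.le, hv.2⟩⟩).2 trivial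
  obtain ⟨b, hb⟩ := all_used P.acyclic (fun v => P.pot v.1) h0 hα
    (fun i e he => P.pot_lt e.1 e.2 ((hA e).1 ⟨i, he⟩))
    (fun e he => P.pot_le e.1 e.2 (fun h => by
      obtain ⟨b, hb⟩ := (hA e).2 h
      exact he b hb)) hb0
  have hik : i ≠ P.k := hv.1.ne
  refine ⟨b, P.merge_next (hα.1 b) hb ?_ ?_⟩
  · intro h
    have := congrArg Subtype.val h
    simp [graph, vR, dst, hik] at this
  · intro g hg
    refine P.out_mi i a g ?_
    rw [hg]; simp [dst, hik]

/-- index set of merging edges -/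
def ms : Finset (ℕ × ℕ) := Finset.range P.k ×ˢ Finset.range P.n
def es : Finset (ℕ × ℕ) := Finset.range P.s ×ˢ Finset.Ico P.s P.t ∪
  Finset.Ico P.s P.t ×ˢ Finset.Ico P.t P.k

theorem ms_card : P.ms.card = P.k * P.n := by simp [ms]

theorem es_card : P.es.card = P.s * (P.t - P.s) + (P.t - P.s) * (P.k - P.t) := by
  rw [es, Finset.card_union_of_disjoint]
  · simp
  · rw [Finset.disjoint_left]
    rintro ⟨x, y⟩ h h'
    simp at h h'
    omega

theorem count {C : Set P.graph.E} (h1 : ∀ i a (hv : P.valid (.m i a)), ⟨.m i a, hv⟩ ∈ C)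
    (h2 : ∀ x y (hv : P.valid (.e x y)), ⟨.e x y, hv⟩ ∈ C) :
    P.n * P.k + (P.s * (P.t - P.s) + (P.t - P.s) * (P.k - P.t)) ≤ C.ncard := by
  classical
  have hfin := P.graph.fintE
  let F : Finset RE := P.ms.image (fun z => .m z.1 z.2) ∪ P.es.image (fun z => .e z.1 z.2)
  have hF : F.card = P.n * P.k + (P.s * (P.t - P.s) + (P.t - P.s) * (P.k - P.t)) := by
    rw [Finset.card_union_of_disjoint, Finset.card_image_of_injective, Finset.card_image_of_injective,
      ms_card, es_card, mul_comm P.n]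
    · rintro ⟨a, b⟩ ⟨c, d⟩ h; simpa using h
    · rintro ⟨a, b⟩ ⟨c, d⟩ h; simpa using h
    · rw [Finset.disjoint_left]
      intro x h h'
      simp only [Finset.mem_image] at h h'
      obtain ⟨a, -, rfl⟩ := h
      obtain ⟨b, -, h⟩ := h'
      cases h
  rw [← hF, ← Set.ncard_coe_finset]
  have hsub : (F : Set RE) ⊆ Subtype.val '' C := by
    intro e he
    simp only [F, Finset.coe_union, Finset.coe_image] at he
    rcases he with ⟨⟨i, a⟩, h, rfl⟩ | ⟨⟨x, y⟩, h, rfl⟩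
    · refine ⟨⟨.m i a, ?_⟩, h1 _ _ _, rfl⟩
      simpa [ms, valid] using h
    · refine ⟨⟨.e x y, ?_⟩, h2 _ _ _, rfl⟩
      simp [es] at h
      simp only [valid, cross]
      omega
  refine (Set.ncard_le_ncard hsub ((Set.toFinite C).image _)).trans ?_
  exact Set.ncard_image_le (Set.toFinite C)

theorem lower (c : Fin (P.k + 1) → ℕ) (hc : ∀ i : Fin P.k, c i.castSucc = 1)
    (hl : c (Fin.last P.k) = P.n) :
    MAtLeast c (P.n * P.k + (P.s * (P.t - P.s) + (P.t - P.s) * (P.k - P.t))) := by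
  refine ⟨P.graph, fun i => P.vS i (by omega), fun i => P.vR i (by omega), ⟨P.acyclic, ?_, ?_⟩, ?_, ?_⟩
  · intro i j h
    have := congrArg Subtype.val h
    simp only [vR, RV.R.injEq] at this
    exact Fin.ext this
  · intro i
    induction i using Fin.lastCases with
    | last =>
      rw [hl]
      obtain ⟨α, hα, -⟩ := P.alpha
      exact ⟨⟨α, hα⟩, P.cutSk _⟩
    | cast i =>
      rw [hc]
      obtain ⟨p, hp⟩ := P.beta i i.2
      refine ⟨⟨fun _ => p, fun _ => hp, ?_⟩, P.cutS i i.2 _⟩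
      intro x y hxy
      exact absurd (Subsingleton.elim x y) hxy
  · intro i j h
    have := congrArg Subtype.val h
    simp only [vS, RV.S.injEq] at this
    exact Fin.ext this
  · intro α hα
    have b0 : ∀ i : Fin P.k, 0 < c i.castSucc := fun i => by rw [hc]; omega
    have hb : ∀ i : Fin P.k, P.graph.IsPathFrom (P.vS i i.2.le) (P.vR i i.2.le)
        (α i.castSucc ⟨0, b0 i⟩) := fun i => (hα i.castSucc).1 _
    refine P.count ?_ ?_
    · intro i a hv
      have ha := hα (Fin.last P.k)
      have : ∃ b, [(⟨.la i a, ⟨hv.1.le, hv.2⟩⟩ : P.graph.E), ⟨.m i a, hv⟩] <:+: α (Fin.last P.k) b := by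
        generalize α (Fin.last P.k) = A at ha
        revert A
        rw [hl]
        intro A hA
        exact P.use_a hv hA
      obtain ⟨b, hb'⟩ := this
      refine ⟨Fin.last P.k, (⟨i, hv.1⟩ : Fin P.k).castSucc, (Fin.castSucc_lt_last _).ne', b,
        ⟨0, b0 _⟩, _, _, ?_, hb', P.use_b hv hv.1 (hb ⟨i, hv.1⟩)⟩
      intro h
      have := congrArg Subtype.val h
      simp at this
    · intro x y hv
      have hxy : x < P.k ∧ y < P.k ∧ x ≠ y := by
        have h1 := P.hst
        have h2 := P.htk
        simp only [valid, cross] at hv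
        omega
      obtain ⟨hx, hy, hne⟩ := hxy
      refine ⟨(⟨x, hx⟩ : Fin P.k).castSucc, (⟨y, hy⟩ : Fin P.k).castSucc, ?_,
        ⟨0, b0 _⟩, ⟨0, b0 _⟩, _, _, ?_, P.use_x hv hx (hb ⟨x, hx⟩), P.use_y hv hy (hb ⟨y, hy⟩)⟩
      · intro h
        have := congrArg Fin.val h
        simp at this
        exact hne this
      · intro h
        have := congrArg Subtype.val h
        simp at this

end Par

theorem lower_main (k n : ℕ) (hk : 0 < k) (hn : 0 < n) (h : 3 * k - 1 ≤ 4 * n)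
    (c : Fin (k + 1) → ℕ) (hc : ∀ i : Fin k, c i.castSucc = 1)
    (hl : c (Fin.last k) = n) : MAtLeast c (n * k + k ^ 2 / 4) := by
  have key := Par.lower ⟨k, n, (k + 1) / 2 / 2, (k + 1) / 2 / 2 + k / 2, by omega, by omega, hk, hn,
    by omega, by omega⟩ c hc hl
  simp only at key
  convert key using 2
  obtain ⟨s, hs⟩ : ∃ s, s = (k + 1) / 2 / 2 := ⟨_, rfl⟩
  obtain ⟨q, hq⟩ : ∃ q, q = k / 2 := ⟨_, rfl⟩
  rw [← hs, ← hq]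
  have e1 : s + q - s = q := by omega
  obtain ⟨r, hr⟩ : ∃ r, r = k - (s + q) := ⟨_, rfl⟩
  rw [e1, ← hr]
  rcases Nat.even_or_odd' k with ⟨m, rfl | rfl⟩
  · have h1 : q = m := by omega
    have h2 : s + r = m := by omega
    have : s * q + q * r = m * m := by rw [h1, mul_comm s, ← mul_add, h2]
    rw [this]
    have : (2 * m) ^ 2 = 4 * (m * m) := by ring
    rw [this]; omega
  · have h1 : q = m := by omega
    have h2 : s + r = m + 1 := by omega
    have : s * q + q * r = m * m + m := by rw [h1, mul_comm s, ← mul_add, h2]; ring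
    rw [this]
    have : (2 * m + 1) ^ 2 = 4 * (m * m + m) + 1 := by ring
    rw [this]; omega

end MOnes

/-- For all positive integers `k` and `n` with `n ≥ (3k − 1)/4`
(i.e. `3k − 1 ≤ 4n`), `M(1, …, 1, n)` (with `k` ones) equals `nk + ⌊k² / 4⌋`. -/
theorem M_ones_n (k n : ℕ) (hk : 0 < k) (hn : 0 < n) (h : 3 * k - 1 ≤ 4 * n) :
    MEq (Fin.snoc (fun _ : Fin k => 1) n) (n * k + k ^ 2 / 4) := by
  have hc : ∀ i : Fin k, (Fin.snoc (fun _ : Fin k => 1) n : Fin (k + 1) → ℕ) i.castSucc = 1 := by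
    intro i
    exact Fin.snoc_castSucc (α := fun _ => ℕ) n (fun _ : Fin k => 1) i
  have hl : (Fin.snoc (fun _ : Fin k => 1) n : Fin (k + 1) → ℕ) (Fin.last k) = n :=
    Fin.snoc_last (α := fun _ => ℕ) n (fun _ : Fin k => 1)
  refine ⟨?_, MOnes.lower_main k n hk hn h _ hc hl⟩
  have := MOnes.upper k _ hc
  rwa [hl] at this
end

section
/- For every positive integer n, M*(n,n) ≥ (n-1)². Equivalently, there exists an acyclic directed graph with a single source S and two distinct sinks R_1, R_2, with min-cut n from S to each sink, such that every choice of a set of n edge-disjoint paths from S to R_1 and a set of n edge-disjoint paths from S to R_2 yields at least (n-1)² mergings between the two path systems (indeed, one can exhibit such a graph in which each Menger path system is unique and the number of mergings is exactly (n-1)²). -/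
open MultiDigraph

namespace MStarLow

open MultiDigraph

section generic

variable {G : MultiDigraph}

theorem isPath_cons {u v : G.V} {e : G.E} {p : List G.E} (he : G.src e = u)
    (hp : G.IsPathFrom (G.dst e) v p) : G.IsPathFrom u v (e :: p) := by
  obtain ⟨h0, h1, h2, h3⟩ := hp
  cases p with
  | nil => exact absurd rfl h0
  | cons f q =>
    refine ⟨by simp, ?_, by simpa using he, by simpa using h3⟩
    exact List.isChain_cons_cons.2 ⟨(h2 f (by simp)).symm, h1⟩

theorem isPath_single {u v : G.V} {e : G.E} (he : G.src e = u) (hv : G.dst e = v) :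
    G.IsPathFrom u v [e] :=
  ⟨by simp, List.isChain_singleton _, by simpa using he, by simpa using hv⟩

theorem isPath_ind {v : G.V} {motive : G.V → List G.E → Prop}
    (single : ∀ e, G.dst e = v → motive (G.src e) [e])
    (cons : ∀ e p, G.IsPathFrom (G.dst e) v p → motive (G.dst e) p → motive (G.src e) (e :: p)) :
    ∀ (p : List G.E) (u : G.V), G.IsPathFrom u v p → motive u p := by
  intro p
  induction p with
  | nil => intro u h; exact absurd rfl h.1
  | cons e p ih =>
    intro u h
    obtain ⟨h0, h1, h2, h3⟩ := h
    have hu : G.src e = u := h2 e (by simp)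
    subst hu
    cases p with
    | nil => exact single e (h3 e (by simp))
    | cons f q =>
      have h1' := List.isChain_cons_cons.1 h1
      have hp : G.IsPathFrom (G.dst e) v (f :: q) :=
        ⟨by simp, h1'.2, by simpa using h1'.1.symm, by simpa using h3⟩
      exact cons e _ hp (ih _ hp)

theorem telescoping (h : G.V → ℤ) {u v : G.V} {p : List G.E} (hp : G.IsPathFrom u v p) :
    (p.map (fun e => h (G.dst e) - h (G.src e))).sum = h v - h u := by
  refine isPath_ind (v := v)
    (motive := fun u p => (p.map (fun e => h (G.dst e) - h (G.src e))).sum = h v - h u)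
    ?_ ?_ p u hp
  · intro e he; simp [he]
  · intro e p _ ih; simp only [List.map_cons, List.sum_cons, ih]; ring

theorem rank_lt (r : G.V → ℤ) (hr : ∀ e, r (G.src e) < r (G.dst e)) {u v : G.V} {p : List G.E}
    (hp : G.IsPathFrom u v p) : r u < r v := by
  refine isPath_ind (v := v) (motive := fun u _ => r u < r v) ?_ ?_ p u hp
  · intro e he; rw [← he]; exact hr e
  · intro e p _ ih; exact (hr e).trans ih

theorem acyclic_of_rank (r : G.V → ℤ) (hr : ∀ e, r (G.src e) < r (G.dst e)) : G.Acyclic :=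
  fun _ _ hp => lt_irrefl _ (rank_lt r hr hp)

theorem nodup_of_rank (r : G.V → ℤ) (hr : ∀ e, r (G.src e) < r (G.dst e)) {u v : G.V}
    {p : List G.E} (hp : G.IsPathFrom u v p) : p.Nodup := by
  have key : p.Nodup ∧ ∀ e ∈ p, r u ≤ r (G.src e) := by
    refine isPath_ind (v := v)
      (motive := fun u p => p.Nodup ∧ ∀ e ∈ p, r u ≤ r (G.src e)) ?_ ?_ p u hp
    · intro e he; simp
    · intro e p _ ih
      refine ⟨List.nodup_cons.2 ⟨fun hm => ?_, ih.1⟩, ?_⟩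
      · exact absurd (ih.2 e hm) (not_le.2 (hr e))
      · intro f hf
        rcases List.mem_cons.1 hf with rfl | hf
        · exact le_rfl
        · exact (hr e).le.trans (ih.2 f hf)
  exact key.1

theorem infix_next {u v : G.V} {p : List G.E} (hp : G.IsPathFrom u v p) {f : G.E} (hf : f ∈ p)
    (hv : G.dst f ≠ v) : ∃ e, G.src e = G.dst f ∧ [f, e] <:+: p := by
  revert hf
  refine isPath_ind (v := v)
    (motive := fun u p => f ∈ p → ∃ e, G.src e = G.dst f ∧ [f, e] <:+: p) ?_ ?_ p u hp
  · intro e he hf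
    have : f = e := by simpa using hf
    subst this; exact absurd he hv
  · intro e p hp ih hf
    rcases List.mem_cons.1 hf with rfl | hf
    · obtain ⟨h0, -, h2, -⟩ := hp
      cases p with
      | nil => exact absurd rfl h0
      | cons g q => exact ⟨g, h2 g (by simp), ⟨[], q, by simp⟩⟩
    · obtain ⟨g, hg, hi⟩ := ih hf
      exact ⟨g, hg, hi.trans (List.suffix_cons e p).isInfix⟩

open Classical in
/-- Edges used by a system. -/
noncomputable def used {c : ℕ} (α : Fin c → List G.E) : Finset G.E :=
  Finset.univ.biUnion (fun i => (α i).toFinset)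

theorem mem_used {c : ℕ} {α : Fin c → List G.E} {e : G.E} : e ∈ used α ↔ ∃ i, e ∈ α i := by
  simp [used]

theorem sum_used (r : G.V → ℤ) (hr : ∀ e, r (G.src e) < r (G.dst e)) (h : G.V → ℤ) {u v : G.V}
    {c : ℕ} {α : Fin c → List G.E} (hα : G.MengerSystem u v c α) :
    ∑ e ∈ used α, (h (G.dst e) - h (G.src e)) = c * (h v - h u) := by
  classical
  unfold used
  rw [Finset.sum_biUnion]
  · have : ∀ i ∈ (Finset.univ : Finset (Fin c)),
        ∑ e ∈ (α i).toFinset, (h (G.dst e) - h (G.src e)) = h v - h u := by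
      intro i _
      rw [List.sum_toFinset _ (nodup_of_rank r hr (hα.1 i)), telescoping h (hα.1 i)]
    rw [Finset.sum_congr rfl this]
    simp only [Finset.sum_const, Finset.card_univ, Fintype.card_fin, nsmul_eq_mul]
  · intro i _ j _ hij
    simp only [Function.onFun]
    rw [Finset.disjoint_left]
    intro e he he'
    exact hα.2 i j hij e (by simpa using he) (by simpa using he')

/-- The key uniqueness (complementary slackness) argument. -/
theorem unique_used (r : G.V → ℤ) (hr : ∀ e, r (G.src e) < r (G.dst e)) (h : G.V → ℤ) {u v : G.V}
    {c : ℕ} {α β : Fin c → List G.E} (hα : G.MengerSystem u v c α) (hβ : G.MengerSystem u v c β)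
    (hpos : ∀ e, e ∈ used β → h (G.src e) < h (G.dst e))
    (hneg : ∀ e, e ∉ used β → h (G.dst e) < h (G.src e)) :
    ∀ e ∈ used β, e ∈ used α := by
  classical
  have e1 := sum_used r hr h hα
  have e2 := sum_used r hr h hβ
  intro e he
  by_contra hne
  have s1 := Finset.sum_inter_add_sum_sdiff (used α) (used β) (fun e => h (G.dst e) - h (G.src e))
  have s2 := Finset.sum_inter_add_sum_sdiff (used β) (used α) (fun e => h (G.dst e) - h (G.src e))
  rw [Finset.inter_comm] at s2
  have n1 : ∑ e ∈ used α \ used β, (h (G.dst e) - h (G.src e)) ≤ 0 := by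
    refine Finset.sum_nonpos fun f hf => ?_
    have := hneg f (Finset.mem_sdiff.1 hf).2
    linarith
  have n2 : 0 < ∑ e ∈ used β \ used α, (h (G.dst e) - h (G.src e)) := by
    refine Finset.sum_pos (fun f hf => ?_) ⟨e, Finset.mem_sdiff.2 ⟨he, hne⟩⟩
    have := hpos f (Finset.mem_sdiff.1 hf).1
    linarith
  linarith

end generic

section abstractGraph

variable (A Y : Type) [Fintype A] [Fintype Y] (nx : Bool → A ⊕ Y → Option Y)

/-- The graph: every root / node `x` has a main edge `(x, none)` and two outgoing
connecting edges `(x, some g)`. -/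
abbrev Gr : MultiDigraph where
  V := Option Bool ⊕ (Y ⊕ (A ⊕ Y))
  E := (A ⊕ Y) × Option Bool
  fintV := inferInstance
  fintE := inferInstance
  src := fun e => match e with
    | (Sum.inl _, none) => Sum.inl none
    | (Sum.inr y, none) => Sum.inr (Sum.inl y)
    | (x, some _) => Sum.inr (Sum.inr x)
  dst := fun e => match e with
    | (x, none) => Sum.inr (Sum.inr x)
    | (x, some g) => match nx g x with
      | none => Sum.inl (some g)
      | some y => Sum.inr (Sum.inl y)

/-- start vertex of the main edge -/
def sv (x : A ⊕ Y) : (Gr A Y nx).V := match x with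
  | Sum.inl _ => Sum.inl none
  | Sum.inr y => Sum.inr (Sum.inl y)

/-- target of a connecting edge -/
def dv (g : Bool) (o : Option Y) : (Gr A Y nx).V := match o with
  | none => Sum.inl (some g)
  | some y => Sum.inr (Sum.inl y)

/-- sink -/
def rv (g : Bool) : (Gr A Y nx).V := Sum.inl (some g)
/-- source -/
def srcv : (Gr A Y nx).V := Sum.inl none
/-- end vertex of the main edge -/
def tv (x : A ⊕ Y) : (Gr A Y nx).V := Sum.inr (Sum.inr x)

theorem src_none (x : A ⊕ Y) : (Gr A Y nx).src (x, none) = sv A Y nx x := by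
  cases x <;> rfl
theorem dst_none (x : A ⊕ Y) : (Gr A Y nx).dst (x, none) = tv A Y nx x := by
  cases x <;> rfl
theorem src_some (x : A ⊕ Y) (g : Bool) : (Gr A Y nx).src (x, some g) = tv A Y nx x := by
  cases x <;> rfl
theorem dst_some (x : A ⊕ Y) (g : Bool) :
    (Gr A Y nx).dst (x, some g) = dv A Y nx g (nx g x) := by
  cases x <;> rfl

theorem src_eq_s {e : (Gr A Y nx).E} {y : Y} (h : (Gr A Y nx).src e = Sum.inr (Sum.inl y)) :
    e = (Sum.inr y, none) := by
  obtain ⟨x, o⟩ := e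
  cases o with
  | some g =>
    rw [src_some] at h; simp [tv] at h
  | none =>
    rw [src_none] at h
    cases x with
    | inl a => simp [sv] at h
    | inr z => simp [sv] at h; rw [h]

theorem src_eq_S {e : (Gr A Y nx).E} (h : (Gr A Y nx).src e = srcv A Y nx) :
    ∃ a, e = (Sum.inl a, none) := by
  obtain ⟨x, o⟩ := e
  cases o with
  | some g =>
    rw [src_some] at h; simp [tv, srcv] at h
  | none =>
    rw [src_none] at h
    cases x with
    | inl a => exact ⟨a, rfl⟩
    | inr z => simp [sv, srcv] at h

/-- Existence of the canonical paths. -/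
theorem exists_path (H : A ⊕ Y → ℕ) (B : ℕ) (hB : ∀ x, H x ≤ B) (g : Bool)
    (hH : ∀ x y, nx g x = some y → H x < H (Sum.inr y))
    (row : A ⊕ Y → A) (hrow : ∀ x y, nx g x = some y → row (Sum.inr y) = row x) :
    ∀ (k : ℕ) (x : A ⊕ Y), B - H x = k → ∃ p : List (Gr A Y nx).E,
      (Gr A Y nx).IsPathFrom (sv A Y nx x) (rv A Y nx g) p ∧
      (∀ e ∈ p, (e.2 = none ∨ e.2 = some g) ∧ row e.1 = row x) ∧
      (x, none) ∈ p ∧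
      (∀ z, (z, none) ∈ p → (z, some g) ∈ p ∧ ∀ y, nx g z = some y → (Sum.inr y, none) ∈ p) := by
  intro k
  induction k using Nat.strong_induction_on with
  | _ k ih =>
  intro x hk
  rcases hx : nx g x with _ | y
  · refine ⟨[(x, none), (x, some g)], ?_, ?_, ?_, ?_⟩
    · refine isPath_cons (src_none A Y nx x) ?_
      rw [dst_none]
      refine isPath_single (src_some A Y nx x g) ?_
      rw [dst_some, hx]; rfl
    · intro e he
      simp only [List.mem_cons, List.not_mem_nil, or_false] at he
      rcases he with rfl | rfl <;> simp
    · exact List.mem_cons_self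
    · intro z hz
      simp only [List.mem_cons, List.not_mem_nil, or_false, Prod.mk.injEq] at hz
      have : z = x := by
        rcases hz with h | h
        · exact h.1
        · exact h.1
      subst this
      refine ⟨by simp, ?_⟩
      intro y hy; rw [hx] at hy; cases hy
  · have h1 := hH x y hx
    have h2 := hB (Sum.inr y)
    obtain ⟨p, p1, p2, p3, p4⟩ := ih (B - H (Sum.inr y)) (by omega) (Sum.inr y) rfl
    refine ⟨(x, none) :: (x, some g) :: p, ?_, ?_, ?_, ?_⟩
    · refine isPath_cons (src_none A Y nx x) ?_
      rw [dst_none]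
      refine isPath_cons (src_some A Y nx x g) ?_
      rw [dst_some, hx]; exact p1
    · intro e he
      simp only [List.mem_cons] at he
      rcases he with rfl | rfl | he
      · simp
      · simp
      · have := p2 e he
        rw [hrow x y hx] at this; exact this
    · exact List.mem_cons_self
    · intro z hz
      simp only [List.mem_cons, Prod.mk.injEq] at hz
      have : z = x ∨ (z, none) ∈ p := by
        rcases hz with h | h | h
        · exact Or.inl h.1
        · exact Or.inl h.1
        · exact Or.inr h
      rcases this with rfl | h
      · refine ⟨by simp, ?_⟩
        intro y' hy'
        rw [hx] at hy'; cases hy'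
        exact List.mem_cons_of_mem _ (List.mem_cons_of_mem _ p3)
      · have := p4 z h
        refine ⟨List.mem_cons_of_mem _ (List.mem_cons_of_mem _ this.1), fun y' hy' => ?_⟩
        exact List.mem_cons_of_mem _ (List.mem_cons_of_mem _ (this.2 y' hy'))

theorem exists_system {n : ℕ} (nx : Bool → Fin n ⊕ Y → Option Y) (H : Fin n ⊕ Y → ℕ) (B : ℕ)
    (hB : ∀ x, H x ≤ B) (g : Bool)
    (hH : ∀ x y, nx g x = some y → H x < H (Sum.inr y))
    (row : Fin n ⊕ Y → Fin n) (hrow : ∀ x y, nx g x = some y → row (Sum.inr y) = row x)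
    (hroot : ∀ a, row (Sum.inl a) = a) (hpred : ∀ y, ∃ x, nx g x = some y) :
    ∃ β : Fin n → List (Gr (Fin n) Y nx).E,
      (Gr (Fin n) Y nx).MengerSystem (srcv _ Y nx) (rv _ Y nx g) n β ∧
      ∀ e, e ∈ used β ↔ (e.2 = none ∨ e.2 = some g) := by
  have key := fun a : Fin n => exists_path (Fin n) Y nx H B hB g hH row hrow _ (Sum.inl a) rfl
  choose β b1 b2 b3 b4 using key
  have cover : ∀ (k : ℕ) (x : Fin n ⊕ Y), H x = k → (x, none) ∈ β (row x) := by
    intro k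
    induction k using Nat.strong_induction_on with
    | _ k ih =>
    intro x hk
    cases x with
    | inl a => rw [hroot]; exact b3 a
    | inr y =>
      obtain ⟨x, hx⟩ := hpred y
      have := ih (H x) (by rw [← hk]; exact hH x y hx) x rfl
      rw [hrow x y hx]
      exact (b4 _ x this).2 y hx
  refine ⟨β, ⟨b1, ?_⟩, ?_⟩
  · intro i j hij e hi hj
    apply hij
    have h1 := (b2 i e hi).2
    have h2 := (b2 j e hj).2
    rw [hroot] at h1 h2
    rw [← h1, ← h2]
  · intro e
    rw [mem_used]
    constructor
    · rintro ⟨i, hi⟩; exact (b2 i e hi).1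
    · obtain ⟨x, o⟩ := e
      rintro (h | h)
      · simp only at h; subst h; exact ⟨_, cover _ x rfl⟩
      · simp only at h; subst h; exact ⟨_, (b4 _ x (cover _ x rfl)).1⟩

theorem no_more {n : ℕ} (nx : Bool → Fin n ⊕ Y → Option Y) (v : (Gr (Fin n) Y nx).V) :
    ¬ ∃ α : Fin (n + 1) → List (Gr (Fin n) Y nx).E,
      (Gr (Fin n) Y nx).MengerSystem (srcv _ Y nx) v (n + 1) α := by
  rintro ⟨α, h1, h2⟩
  have : ∀ i, ∃ a : Fin n, (Sum.inl a, none) ∈ α i := by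
    intro i
    obtain ⟨h0, -, h3, -⟩ := h1 i
    rcases hα : α i with _ | ⟨e, p⟩
    · exact absurd hα h0
    · obtain ⟨a, ha⟩ := src_eq_S _ Y nx (h3 e (by rw [hα]; simp))
      exact ⟨a, by rw [ha]; exact List.mem_cons_self⟩
  choose f hf using this
  have hinj : Function.Injective f := by
    intro i j hij
    by_contra hne
    exact h2 i j hne _ (hf i) (hij ▸ hf j)
  have := Fintype.card_le_of_injective f hinj
  simp at this

/-- The abstract lower bound. -/
theorem abstract_bound {n : ℕ} (nx : Bool → Fin n ⊕ Y → Option Y) (H : Fin n ⊕ Y → ℕ) (B : ℕ)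
    (hB : ∀ x, H x ≤ B)
    (hH : ∀ g x y, nx g x = some y → H x < H (Sum.inr y))
    (row : Bool → Fin n ⊕ Y → Fin n)
    (hrow : ∀ g x y, nx g x = some y → row g (Sum.inr y) = row g x)
    (hroot : ∀ g a, row g (Sum.inl a) = a) (hpred : ∀ g y, ∃ x, nx g x = some y)
    (r : (Gr (Fin n) Y nx).V → ℤ)
    (hr : ∀ e, r ((Gr (Fin n) Y nx).src e) < r ((Gr (Fin n) Y nx).dst e))
    (h : Bool → (Gr (Fin n) Y nx).V → ℤ)
    (hm : ∀ g x, h g (sv _ Y nx x) < h g (tv _ Y nx x))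
    (hp : ∀ g x, h g (tv _ Y nx x) < h g (dv _ Y nx g (nx g x)))
    (hn : ∀ g x, h g (dv _ Y nx (!g) (nx (!g) x)) < h g (tv _ Y nx x)) :
    MstarAtLeast ![n, n] (Fintype.card Y) := by
  have sys := fun g => exists_system Y nx H B hB g (hH g) (row g) (hrow g) (hroot g) (hpred g)
  have main : ∀ g (α : Fin n → List (Gr (Fin n) Y nx).E),
      (Gr (Fin n) Y nx).MengerSystem (srcv _ Y nx) (rv _ Y nx g) n α →
      ∀ y, ∃ x i, [(x, some g), (Sum.inr y, none)] <:+: α i := by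
    intro g α hα y
    obtain ⟨β, hβ, hu⟩ := sys g
    have hsub := unique_used r hr (h g) hα hβ (by
      rintro ⟨x, o⟩ he
      rw [hu] at he
      rcases he with he | he
      · simp only at he; subst he; rw [src_none, dst_none]; exact hm g x
      · simp only at he; subst he; rw [src_some, dst_some]; exact hp g x) (by
      rintro ⟨x, o⟩ he
      rw [hu] at he
      rcases o with _ | g'
      · simp at he
      · have : g' = !g := by
          cases g <;> cases g' <;> simp at he ⊢
        subst this
        rw [src_some, dst_some]; exact hn g x)
    obtain ⟨x, hx⟩ := hpred g y
    obtain ⟨i, hi⟩ := mem_used.1 (hsub (x, some g) ((hu _).2 (Or.inr rfl)))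
    have hd : (Gr (Fin n) Y nx).dst (x, some g) = Sum.inr (Sum.inl y) := by
      rw [dst_some, hx]; rfl
    obtain ⟨e, he, hinf⟩ := infix_next (hα.1 i) hi (by rw [hd]; simp [rv])
    rw [hd] at he
    have := src_eq_s _ Y nx he
    subst this
    exact ⟨x, i, hinf⟩
  refine ⟨Gr (Fin n) Y nx, fun _ => srcv _ Y nx, ![rv _ Y nx true, rv _ Y nx false], 
    ⟨acyclic_of_rank r hr, ?_, ?_⟩, fun _ _ => rfl, ?_⟩
  · intro i j hij
    fin_cases i <;> fin_cases j <;> simp [rv] at hij ⊢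
  · intro i
    fin_cases i
    · exact ⟨⟨_, (sys true).choose_spec.1⟩, no_more Y nx _⟩
    · exact ⟨⟨_, (sys false).choose_spec.1⟩, no_more Y nx _⟩
  · intro α hα
    have m0 := main true (α 0) (hα 0)
    have m1 := main false (α 1) (hα 1)
    unfold mergingCount
    have hfin : Finite (Gr (Fin n) Y nx).E := @Finite.of_fintype _ (Gr (Fin n) Y nx).fintE
    have hinj : Function.Injective (fun y : Y => ((Sum.inr y, none) : (Gr (Fin n) Y nx).E)) := by
      intro y z hyz
      simpa using (Prod.mk.inj hyz).1
    rw [← Nat.card_eq_fintype_card, ← Set.ncard_univ, ← Set.ncard_image_of_injective _ hinj]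
    refine Set.ncard_le_ncard ?_ (Set.toFinite _)
    rintro _ ⟨y, -, rfl⟩
    obtain ⟨x, i, hi⟩ := m0 y
    obtain ⟨z, j, hj⟩ := m1 y
    refine ⟨0, 1, by decide, i, j, (x, some true), (z, some false), ?_, hi, hj⟩
    intro hc
    simpa using (Prod.mk.inj hc).2

end abstractGraph

section wrapper

/-- Vertex potential from values on starts / ends of main edges. -/
def potV {A Y : Type} (S0 : ℤ) (R0 : Bool → ℤ) (s : Y → ℤ) (t : A ⊕ Y → ℤ) :
    Option Bool ⊕ (Y ⊕ (A ⊕ Y)) → ℤ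
  | Sum.inl none => S0
  | Sum.inl (some g) => R0 g
  | Sum.inr (Sum.inl y) => s y
  | Sum.inr (Sum.inr x) => t x

theorem bound_wrapper {n : ℕ} (Y : Type) [Fintype Y] (nx : Bool → Fin n ⊕ Y → Option Y)
    (H : Fin n ⊕ Y → ℕ)
    (hH : ∀ g x y, nx g x = some y → H x < H (Sum.inr y))
    (row : Bool → Fin n ⊕ Y → Fin n)
    (hrow : ∀ g x y, nx g x = some y → row g (Sum.inr y) = row g x)
    (hroot : ∀ g a, row g (Sum.inl a) = a) (hpred : ∀ g y, ∃ x, nx g x = some y)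
    (s : Bool → Y → ℤ) (t : Bool → Fin n ⊕ Y → ℤ)
    (hm : ∀ g y, s g y < t g (Sum.inr y))
    (hp : ∀ g x y, nx g x = some y → t g x < s g y)
    (hn : ∀ g x y, nx (!g) x = some y → s g y < t g x) :
    MstarAtLeast ![n, n] (Fintype.card Y) := by
  obtain ⟨B, hB⟩ := (Set.finite_range H).bddAbove
  have hB : ∀ x, H x ≤ B := fun x => hB ⟨x, rfl⟩
  obtain ⟨M, hM⟩ := (Set.finite_range (fun p : Bool × (Fin n ⊕ Y) => |t p.1 p.2|)).bddAbove
  have hM : ∀ g x, |t g x| ≤ M := fun g x => hM ⟨(g, x), rfl⟩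
  refine abstract_bound Y nx H B hB hH row hrow hroot hpred
    (potV (-1) (fun _ => 2 * B + 5) (fun y => 2 * H (Sum.inr y)) (fun x => 2 * H x + 1)) ?_
    (fun g => potV (-M - 1) (fun g' => if g' = g then M + 1 else - M - 1) (s g) (t g)) ?_ ?_ ?_
  · rintro ⟨x, o⟩
    cases o with
    | none =>
      rw [src_none, dst_none]
      cases x with
      | inl a => simp only [sv, tv, potV]; omega
      | inr y => simp only [sv, tv, potV]; omega
    | some g =>
      rw [src_some, dst_some]
      rcases hx : nx g x with _ | y
      · have := hB x
        simp only [dv, tv, potV]; omega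
      · have := hH g x y hx
        simp only [dv, tv, potV]; omega
  · intro g x
    cases x with
    | inl a =>
      have := abs_le.1 (hM g (Sum.inl a))
      simp only [sv, tv, potV]; omega
    | inr y => exact hm g y
  · intro g x
    rcases hx : nx g x with _ | y
    · have := abs_le.1 (hM g x)
      simp only [dv, tv, potV, if_true]; omega
    · exact hp g x y hx
  · intro g x
    rcases hx : nx (!g) x with _ | y
    · have := abs_le.1 (hM g x)
      have hg : ¬ ((!g) = g) := by cases g <;> simp
      simp only [dv, tv, potV, if_neg hg]; omega
    · exact hn g x y hx

end wrapper

section concrete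

/-- Node with given coordinates. -/
def mk (N i b : ℕ) : Option (Fin N × Fin N) :=
  if h : i < N ∧ b < N then some (⟨i, h.1⟩, ⟨b, h.2⟩) else none

theorem mk_eq {N i b : ℕ} {y : Fin N × Fin N} :
    mk N i b = some y ↔ (y.1 : ℕ) = i ∧ (y.2 : ℕ) = b := by
  obtain ⟨⟨y1, h1⟩, ⟨y2, h2⟩⟩ := y
  unfold mk
  split
  · simp [eq_comm]
  · simp; omega

/-- The successor functions of the two groups. -/
def nxt (N : ℕ) : Bool → Fin (N + 1) ⊕ (Fin N × Fin N) → Option (Fin N × Fin N)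
  | true, Sum.inl k => if (k : ℕ) = 0 then mk N 0 (N - 1) else mk N k 0
  | true, Sum.inr (i, b) =>
      if (b : ℕ) + 1 < i then mk N i (b + 1)
      else if (b : ℕ) + 1 = i then mk N i (N - 1)
      else if (i : ℕ) < b then mk N i (b - 1) else none
  | false, Sum.inl k => mk N 0 (N - k)
  | false, Sum.inr (i, b) =>
      if (i : ℕ) < b then mk N (i + 1) b
      else if (i : ℕ) = b then (if (b : ℕ) + 1 < N then mk N (N - 1) b else none)
      else if (b : ℕ) + 1 < i then mk N (i - 1) b else none

/-- topological height -/
def hgt (N : ℕ) : Fin (N + 1) ⊕ (Fin N × Fin N) → ℕ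
  | Sum.inl _ => 0
  | Sum.inr (i, b) =>
      if (i : ℕ) ≤ b then (i : ℕ) * (2 * N) + (N - b) else (b : ℕ) * (2 * N) + (2 * N - i)

/-- index of the path -/
def rowf (N : ℕ) : Bool → Fin (N + 1) ⊕ (Fin N × Fin N) → Fin (N + 1)
  | _, Sum.inl k => k
  | true, Sum.inr (i, _) => ⟨i, by omega⟩
  | false, Sum.inr (_, b) => ⟨N - b, by omega⟩

/-- potential at the start of nodes -/
def sp (N : ℕ) : Bool → Fin N × Fin N → ℤ
  | true, (i, b) =>
      if (b : ℕ) < i then 2 * ((i : ℤ) ^ 2 + 1 + (b : ℤ))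
      else 2 * (((N : ℤ) - (b : ℤ) + (i : ℤ)) ^ 2 - (i : ℤ))
  | false, (i, b) =>
      if (i : ℕ) ≤ b then 2 * ((i : ℤ) + ((b : ℤ) ^ 2 + (b : ℤ) + 1))
      else 2 * (((N : ℤ) - (i : ℤ) + (b : ℤ)) * ((N : ℤ) - (i : ℤ) + (b : ℤ) + 1) - (b : ℤ))

/-- potential at the end of nodes -/
def tp (N : ℕ) : Bool → Fin (N + 1) ⊕ (Fin N × Fin N) → ℤ
  | true, Sum.inl k => 2 * (k : ℤ) ^ 2 + 1
  | true, Sum.inr (i, b) =>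
      if (b : ℕ) < i then 2 * ((i : ℤ) ^ 2 + 1 + (b : ℤ)) + 1
      else 2 * (((N : ℤ) - (b : ℤ) + 1 + (i : ℤ)) ^ 2 - (i : ℤ)) - 1
  | false, Sum.inl k =>
      2 * (((N : ℤ) - (k : ℤ)) ^ 2 + ((N : ℤ) - (k : ℤ))) + 1
  | false, Sum.inr (i, b) =>
      if (i : ℕ) ≤ b then 2 * ((i : ℤ) + ((b : ℤ) ^ 2 + (b : ℤ) + 1)) + 1
      else 2 * (((N : ℤ) - (i : ℤ) + (b : ℤ) + 1) * ((N : ℤ) - (i : ℤ) + (b : ℤ) + 2)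
        - (b : ℤ)) - 1

/-- Case analysis for the first group. -/
theorem nxt_true_cases {N : ℕ} {x : Fin (N + 1) ⊕ (Fin N × Fin N)} {y : Fin N × Fin N}
    (h : nxt N true x = some y) :
    (∃ k : Fin (N + 1), x = Sum.inl k ∧ (y.1 : ℕ) = k ∧
      (((k : ℕ) = 0 ∧ (y.2 : ℕ) + 1 = N) ∨ (0 < (k : ℕ) ∧ (y.2 : ℕ) = 0))) ∨
    (∃ i b : Fin N, x = Sum.inr (i, b) ∧ (y.1 : ℕ) = i ∧
      (((b : ℕ) + 1 < i ∧ (y.2 : ℕ) = b + 1) ∨ ((b : ℕ) + 1 = i ∧ (y.2 : ℕ) + 1 = N) ∨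
        ((i : ℕ) < b ∧ (y.2 : ℕ) + 1 = b))) := by
  rcases x with k | ⟨i, b⟩
  · left
    refine ⟨k, rfl, ?_⟩
    simp only [nxt] at h
    split at h <;> rw [mk_eq] at h <;> omega
  · right
    refine ⟨i, b, rfl, ?_⟩
    simp only [nxt] at h
    split_ifs at h <;> rw [mk_eq] at h <;> omega

/-- Case analysis for the second group. -/
theorem nxt_false_cases {N : ℕ} {x : Fin (N + 1) ⊕ (Fin N × Fin N)} {y : Fin N × Fin N}
    (h : nxt N false x = some y) :
    (∃ k : Fin (N + 1), x = Sum.inl k ∧ (y.1 : ℕ) = 0 ∧ (y.2 : ℕ) + k = N) ∨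
    (∃ i b : Fin N, x = Sum.inr (i, b) ∧ (y.2 : ℕ) = b ∧
      (((i : ℕ) < b ∧ (y.1 : ℕ) = i + 1) ∨
        ((i : ℕ) = b ∧ (b : ℕ) + 1 < N ∧ (y.1 : ℕ) + 1 = N) ∨
        ((b : ℕ) + 1 < i ∧ (y.1 : ℕ) + 1 = i))) := by
  rcases x with k | ⟨i, b⟩
  · left
    refine ⟨k, rfl, ?_⟩
    simp only [nxt] at h
    rw [mk_eq] at h; omega
  · right
    refine ⟨i, b, rfl, ?_⟩
    simp only [nxt] at h
    split_ifs at h <;> rw [mk_eq] at h <;> omega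

theorem hgt_lt (N : ℕ) (g : Bool) (x : Fin (N + 1) ⊕ (Fin N × Fin N)) (y : Fin N × Fin N)
    (h : nxt N g x = some y) : hgt N x < hgt N (Sum.inr y) := by
  obtain ⟨⟨y1, hy1⟩, ⟨y2, hy2⟩⟩ := y
  cases g with
  | true =>
    rcases nxt_true_cases h with ⟨k, rfl, h1, h2⟩ | ⟨⟨i, hi⟩, ⟨b, hb⟩, rfl, h1, h2⟩
    · simp only [hgt]
      split_ifs <;> (try simp only at h1 h2) <;> omega
    · simp only [hgt] at h1 h2 ⊢
      subst h1
      rcases h2 with ⟨h2, h3⟩ | ⟨h2, h3⟩ | ⟨h2, h3⟩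
      · subst h3
        rw [if_neg (by omega), if_neg (by omega)]
        have : (b + 1) * (2 * N) = b * (2 * N) + 2 * N := by ring
        omega
      · subst h2
        rw [if_neg (by omega), if_pos (by omega)]
        have : (b + 1) * (2 * N) = b * (2 * N) + 2 * N := by ring
        omega
      · rw [if_pos (by omega), if_pos (by omega)]
        omega
  | false =>
    rcases nxt_false_cases h with ⟨k, rfl, h1, h2⟩ | ⟨⟨i, hi⟩, ⟨b, hb⟩, rfl, h1, h2⟩
    · simp only [hgt]
      split_ifs <;> (try simp only at h1 h2) <;> omega
    · simp only [hgt] at h1 h2 ⊢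
      subst h1
      rcases h2 with ⟨h2, h3⟩ | ⟨h2, h3, h4⟩ | ⟨h2, h3⟩
      · subst h3
        rw [if_pos (by omega), if_pos (by omega)]
        have : (i + 1) * (2 * N) = i * (2 * N) + 2 * N := by ring
        omega
      · subst h2
        rw [if_pos (by omega), if_neg (by omega)]
        omega
      · rw [if_neg (by omega), if_neg (by omega)]
        omega

theorem rowf_eq (N : ℕ) (g : Bool) (x : Fin (N + 1) ⊕ (Fin N × Fin N)) (y : Fin N × Fin N)
    (h : nxt N g x = some y) : rowf N g (Sum.inr y) = rowf N g x := by
  obtain ⟨⟨y1, hy1⟩, ⟨y2, hy2⟩⟩ := y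
  cases g with
  | true =>
    rcases nxt_true_cases h with ⟨k, rfl, h1, h2⟩ | ⟨⟨i, hi⟩, ⟨b, hb⟩, rfl, h1, h2⟩
    · apply Fin.ext; simp only [rowf] at h1 ⊢; omega
    · apply Fin.ext; simp only [rowf] at h1 ⊢; omega
  | false =>
    rcases nxt_false_cases h with ⟨k, rfl, h1, h2⟩ | ⟨⟨i, hi⟩, ⟨b, hb⟩, rfl, h1, h2⟩
    · apply Fin.ext; simp only [rowf] at h2 ⊢; omega
    · apply Fin.ext; simp only [rowf] at h1 ⊢; omega

theorem pred_ex (N : ℕ) (g : Bool) (y : Fin N × Fin N) : ∃ x, nxt N g x = some y := by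
  obtain ⟨⟨i, hi⟩, ⟨b, hb⟩⟩ := y
  cases g with
  | true =>
    by_cases h0 : b < i
    · by_cases h1 : b = 0
      · refine ⟨Sum.inl ⟨i, by omega⟩, ?_⟩
        simp only [nxt]
        rw [if_neg (by omega), mk_eq]; constructor <;> simp only <;> omega
      · refine ⟨Sum.inr (⟨i, hi⟩, ⟨b - 1, by omega⟩), ?_⟩
        simp only [nxt]
        rw [if_pos (by omega), mk_eq]; constructor <;> simp only <;> omega
    · by_cases h1 : b + 1 = N
      · by_cases h2 : i = 0
        · refine ⟨Sum.inl ⟨i, by omega⟩, ?_⟩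
          simp only [nxt]
          rw [if_pos (by omega), mk_eq]; constructor <;> simp only <;> omega
        · refine ⟨Sum.inr (⟨i, hi⟩, ⟨i - 1, by omega⟩), ?_⟩
          simp only [nxt]
          rw [if_neg (by omega), if_pos (by omega), mk_eq]; constructor <;> simp only <;> omega
      · refine ⟨Sum.inr (⟨i, hi⟩, ⟨b + 1, by omega⟩), ?_⟩
        simp only [nxt]
        rw [if_neg (by omega), if_neg (by omega), if_pos (by omega), mk_eq]; constructor <;> simp only <;> omega
  | false =>
    by_cases h0 : i ≤ b
    · by_cases h1 : i = 0
      · refine ⟨Sum.inl ⟨N - b, by omega⟩, ?_⟩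
        simp only [nxt]
        rw [mk_eq]; constructor <;> simp only <;> omega
      · refine ⟨Sum.inr (⟨i - 1, by omega⟩, ⟨b, hb⟩), ?_⟩
        simp only [nxt]
        rw [if_pos (by omega), mk_eq]; constructor <;> simp only <;> omega
    · by_cases h1 : i + 1 = N
      · refine ⟨Sum.inr (⟨b, hb⟩, ⟨b, hb⟩), ?_⟩
        simp only [nxt]
        rw [if_neg (by omega), if_pos trivial, if_pos (by omega), mk_eq]; constructor <;> simp only <;> omega
      · refine ⟨Sum.inr (⟨i + 1, by omega⟩, ⟨b, hb⟩), ?_⟩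
        simp only [nxt]
        rw [if_neg (by omega), if_neg (by omega), if_pos (by omega), mk_eq]; constructor <;> simp only <;> omega

theorem sp_lt_tp (N : ℕ) (g : Bool) (y : Fin N × Fin N) : sp N g y < tp N g (Sum.inr y) := by
  obtain ⟨⟨i, hi⟩, ⟨b, hb⟩⟩ := y
  have hi' : (i : ℤ) < N := by exact_mod_cast hi
  have hb' : (b : ℤ) < N := by exact_mod_cast hb
  have i0 : (0 : ℤ) ≤ i := by positivity
  have b0 : (0 : ℤ) ≤ b := by positivity
  cases g with
  | true =>
    simp only [sp, tp]
    split_ifs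
    · linarith
    · nlinarith
  | false =>
    simp only [sp, tp]
    split_ifs
    · linarith
    · nlinarith

theorem tp_lt_sp (N : ℕ) (g : Bool) (x : Fin (N + 1) ⊕ (Fin N × Fin N)) (y : Fin N × Fin N)
    (h : nxt N g x = some y) : tp N g x < sp N g y := by
  obtain ⟨⟨y1, hy1⟩, ⟨y2, hy2⟩⟩ := y
  cases g with
  | true =>
    rcases nxt_true_cases h with ⟨⟨k, hk⟩, rfl, h1, h2⟩ | ⟨⟨i, hi⟩, ⟨b, hb⟩, rfl, h1, h2⟩
    · simp only at h1 h2
      subst h1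
      rcases h2 with ⟨rfl, rfl⟩ | ⟨h2, rfl⟩
      · simp [sp, tp]
      · simp only [sp, tp]; rw [if_pos (by omega)]; push_cast; nlinarith
    · simp only at h1 h2
      subst h1
      rcases h2 with ⟨h2, rfl⟩ | ⟨rfl, rfl⟩ | ⟨h2, rfl⟩
      · simp only [sp, tp]; rw [if_pos (by omega), if_pos (by omega)]; push_cast; nlinarith
      · simp only [sp, tp]; rw [if_pos (by omega), if_neg (by omega)]; push_cast; nlinarith
      · simp only [sp, tp]; rw [if_neg (by omega), if_neg (by omega)]; push_cast; nlinarith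
  | false =>
    rcases nxt_false_cases h with ⟨⟨k, hk⟩, rfl, h1, h2⟩ | ⟨⟨i, hi⟩, ⟨b, hb⟩, rfl, h1, h2⟩
    · simp only at h1 h2
      subst h1 h2
      simp only [sp, tp]; rw [if_pos (by omega)]; push_cast; nlinarith
    · simp only at h1 h2
      subst h1
      rcases h2 with ⟨h2, rfl⟩ | ⟨rfl, h2, rfl⟩ | ⟨h2, rfl⟩
      · simp only [sp, tp]; rw [if_pos (by omega), if_pos (by omega)]; push_cast; nlinarith
      · simp only [sp, tp]; rw [if_pos (by omega), if_neg (by omega)]; push_cast; nlinarith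
      · simp only [sp, tp]; rw [if_neg (by omega), if_neg (by omega)]; push_cast; nlinarith

theorem sp_lt_tp' (N : ℕ) (g : Bool) (x : Fin (N + 1) ⊕ (Fin N × Fin N)) (y : Fin N × Fin N)
    (h : nxt N (!g) x = some y) : sp N g y < tp N g x := by
  obtain ⟨⟨y1, hy1⟩, ⟨y2, hy2⟩⟩ := y
  cases g with
  | false =>
    rcases nxt_true_cases h with ⟨⟨k, hk⟩, rfl, h1, h2⟩ | ⟨⟨i, hi⟩, ⟨b, hb⟩, rfl, h1, h2⟩
    · simp only at h1 h2
      subst h1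
      rcases h2 with ⟨rfl, rfl⟩ | ⟨h2, rfl⟩
      · simp only [sp, tp]; rw [if_pos (by omega)]; push_cast; nlinarith
      · simp only [sp, tp]; rw [if_neg (by omega)]; push_cast; nlinarith
    · simp only at h1 h2
      subst h1
      rcases h2 with ⟨h2, rfl⟩ | ⟨rfl, rfl⟩ | ⟨h2, rfl⟩
      · simp only [sp, tp]; rw [if_neg (by omega), if_neg (by omega)]; push_cast; nlinarith
      · simp only [sp, tp]; rw [if_pos (by omega), if_neg (by omega)]; push_cast; nlinarith
      · simp only [sp, tp]; rw [if_pos (by omega), if_pos (by omega)]; push_cast; nlinarith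
  | true =>
    rcases nxt_false_cases h with ⟨⟨k, hk⟩, rfl, h1, h2⟩ | ⟨⟨i, hi⟩, ⟨b, hb⟩, rfl, h1, h2⟩
    · simp only at h1 h2
      subst h1 h2
      simp only [sp, tp]; rw [if_neg (by omega)]; push_cast; nlinarith
    · simp only at h1 h2
      subst h1
      rcases h2 with ⟨h2, rfl⟩ | ⟨rfl, h2, rfl⟩ | ⟨h2, rfl⟩
      · simp only [sp, tp]; rw [if_neg (by omega), if_neg (by omega)]; push_cast; nlinarith
      · simp only [sp, tp]; rw [if_pos (by omega), if_neg (by omega)]; push_cast; nlinarith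
      · simp only [sp, tp]; rw [if_pos (by omega), if_pos (by omega)]; push_cast; nlinarith

theorem final (N : ℕ) : MstarAtLeast ![N + 1, N + 1] (N ^ 2) := by
  have := bound_wrapper (n := N + 1) (Fin N × Fin N) (nxt N) (hgt N) (hgt_lt N) (rowf N)
    (rowf_eq N) (fun g a => by cases g <;> rfl) (pred_ex N) (sp N) (tp N) (sp_lt_tp N)
    (tp_lt_sp N) (sp_lt_tp' N)
  simpa [sq] using this

end concrete

end MStarLow

/-- For every positive integer `n`, `M*(n, n) ≥ (n − 1)²`: there is an
acyclic graph with a single source, two distinct sinks and min-cut `n` to each sink, in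
which every choice of the two Menger path systems yields at least `(n − 1)²` mergings. -/
theorem Mstar_lower (n : ℕ) (hn : 0 < n) : MstarAtLeast ![n, n] ((n - 1) ^ 2) := by
  obtain ⟨N, rfl⟩ : ∃ N, n = N + 1 := ⟨n - 1, by omega⟩
  exact MStarLow.final N
end

section
/- For every positive integer n, M*(n,n) ≤ ⌈n/2⌉ · (n² - 4n + 5). That is, in every acyclic directed graph with a single source S and two distinct sinks R_1, R_2 with min-cut n from S to each sink, one can choose a set of n edge-disjoint paths from S to R_1 and a set of n edge-disjoint paths from S to R_2 whose number of mergings is at most ⌈n/2⌉(n² - 4n + 5). -/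
open MultiDigraph

namespace MM
open Relation

def Nxt {W : Type} [LinearOrder W] {n : ℕ} (b : W → Fin n) (w v : W) : Prop :=
  b w = b v ∧ w < v ∧ ∀ u, b u = b w → w < u → v ≤ u

def RA {W : Type} [LinearOrder W] {n : ℕ} (a b : W → Fin n) (w w' : W) : Prop :=
  ∃ v, Nxt b w v ∧ a v = a w' ∧ w' < v

section comb
variable {W : Type} [LinearOrder W] {n : ℕ}

def Tau (a b : W → Fin n) (w w' : W) : Prop := ∃ v, Nxt b w v ∧ Nxt a w' v

lemma Nxt.right {b : W → Fin n} {w v v' : W} (h : Nxt b w v) (h' : Nxt b w v') : v = v' :=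
  le_antisymm (h.2.2 v' h'.1.symm h'.2.1) (h'.2.2 v h.1.symm h.2.1)

lemma Nxt.left {b : W → Fin n} {w w' v : W} (h : Nxt b w v) (h' : Nxt b w' v) : w = w' := by
  have e : b w = b w' := h.1.trans h'.1.symm
  rcases lt_trichotomy w w' with hl | hl | hl
  · exact absurd (h.2.2 w' e.symm hl) (not_le.2 h'.2.1)
  · exact hl
  · exact absurd (h'.2.2 w e hl) (not_le.2 h.2.1)

lemma Nxt.ex [Fintype W] {b : W → Fin n} {w u : W} (h : b u = b w) (hl : w < u) :
    ∃ v, Nxt b w v := by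
  classical
  let S : Finset W := Finset.univ.filter (fun v => b v = b w ∧ w < v)
  have hS : S.Nonempty := ⟨u, by simp [S, h, hl]⟩
  have hm := S.min'_mem hS
  refine ⟨S.min' hS, ?_, ?_, ?_⟩
  · simp only [S, Finset.mem_filter] at hm; exact hm.2.1.symm
  · simp only [S, Finset.mem_filter] at hm; exact hm.2.2
  · intro x hx hwx; exact S.min'_le _ (by simp [S, hx, hwx])

lemma Nxt.ex' [Fintype W] {b : W → Fin n} {w u : W} (h : b u = b w) (hl : u < w) :
    ∃ v, Nxt b v w := by
  classical
  let S : Finset W := Finset.univ.filter (fun v => b v = b w ∧ v < w)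
  have hS : S.Nonempty := ⟨u, by simp [S, h, hl]⟩
  have hm := S.max'_mem hS
  simp only [S, Finset.mem_filter] at hm
  refine ⟨S.max' hS, hm.2.1, hm.2.2, ?_⟩
  · intro x hx hwx
    by_contra hc
    push Not at hc
    have := S.le_max' x (by simp [S, hx.trans hm.2.1, hc])
    exact absurd hwx (not_lt.2 this)

lemma Tau.ra {a b : W → Fin n} {w w' : W} (h : Tau a b w w') : RA a b w w' := by
  obtain ⟨v, h1, h2⟩ := h
  exact ⟨v, h1, h2.1.symm, h2.2.1⟩

lemma Tau.rb {a b : W → Fin n} {w w' : W} (h : Tau a b w w') : RA b a w' w := by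
  obtain ⟨v, h1, h2⟩ := h
  exact ⟨v, h2, h1.1.symm, h1.2.1⟩

lemma Tau.sRA {a b : W → Fin n} {w w' : W} (h : ReflTransGen (Tau a b) w w') :
    ReflTransGen (RA a b) w w' := ReflTransGen.mono (fun _ _ => Tau.ra) _ _ h

lemma Tau.sRB {a b : W → Fin n} {w w' : W} (h : ReflTransGen (Tau a b) w w') :
    ReflTransGen (RA b a) w' w := by
  have h1 : ReflTransGen (Function.swap (RA b a)) w w' := ReflTransGen.mono (fun _ _ => Tau.rb) _ _ h
  exact reflTransGen_swap.1 h1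

variable {a b : W → Fin n} (hA : ∀ w, ¬ TransGen (RA a b) w w)
  (hB : ∀ w, ¬ TransGen (RA b a) w w)

include hA in
lemma noA {x y : W} (h : ReflTransGen (Tau a b) x y) (h' : RA a b y x) : False :=
  hA _ (TransGen.head' h' (Tau.sRA h))

include hB in
lemma noB {x y : W} (h : ReflTransGen (Tau a b) x y) (h' : RA b a x y) : False :=
  hB _ (TransGen.head' h' (Tau.sRB h))

include hA hB in
lemma oneDD {x y : W} (h : ReflTransGen (Tau a b) x y) (ea : a x = a y) (eb : b x = b y) :
    x = y := by
  by_contra hne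
  rcases le_total x y with hl | hl
  · rcases ReflTransGen.cases_tail h with h1 | ⟨z, hz, v, h1, h2⟩
    · exact hne h1.symm
    · exact noA hA hz ⟨v, h1, h2.1.symm.trans ea.symm, hl.trans_lt h2.2.1⟩
  · rcases ReflTransGen.cases_head h with h1 | ⟨z, ⟨v, h1, h2⟩, hz⟩
    · exact hne h1
    · exact noB hB hz ⟨v, h2, h1.1.symm.trans eb, hl.trans_lt h1.2.1⟩

include hA hB in
lemma oneVV {x y v w : W} (h : ReflTransGen (Tau a b) x y) (hx : Nxt a x v) (hy : Nxt a y w)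
    (ea : a v = a w) (eb : b v = b w) : v = w := by
  rcases ReflTransGen.cases_tail h with h1 | ⟨z, hz, w', h1, h2⟩
  · subst h1; exact hx.right hy
  · have := hy.right h2
    subst this
    exfalso
    rcases le_total v w with hl | hl
    · exact noA hA hz ⟨w, h1, ea.symm.trans hx.1.symm, hx.2.1.trans_le hl⟩
    · exact noB hB hz ⟨v, hx, eb.trans h1.1.symm, h1.2.1.trans_le hl⟩

include hA hB in
lemma oneVD {x y v : W} (h : ReflTransGen (Tau a b) x y) (hx : Nxt a x v)
    (ea : a v = a y) (eb : b v = b y) : False := by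
  rcases lt_or_ge y v with hl | hl
  · exact noB hB h ⟨v, hx, eb, hl⟩
  · rcases ReflTransGen.cases_tail h with h1 | ⟨z, hz, w, h1, h2⟩
    · subst h1; exact absurd hx.2.1 (not_lt.2 hl)
    · exact noA hA hz ⟨w, h1, h2.1.symm.trans (ea.symm.trans hx.1.symm),
        (hx.2.1.trans_le hl).trans h2.2.1⟩

include hA hB in
lemma oneDV {x y v : W} (h : ReflTransGen (Tau a b) x y) (hne : x ≠ y) (hy : Nxt a y v)
    (ea : a x = a v) (eb : b x = b v) : False := by
  rcases ReflTransGen.cases_tail h with h1 | ⟨z, hz, w, h1, h2⟩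
  · exact hne h1.symm
  have := hy.right h2
  subst this
  rcases lt_or_ge x v with hl | hl
  · exact noA hA hz ⟨v, h1, ea.symm, hl⟩
  · rcases ReflTransGen.cases_head hz with h3 | ⟨t, ⟨u, h3, h4⟩, ht⟩
    · subst h3; exact absurd h1.2.1 (not_lt.2 hl)
    · exact noB hB ht ⟨u, h4, h3.1.symm.trans (eb.trans h1.1.symm),
        (h1.2.1.trans_le hl).trans h3.2.1⟩

lemma Tau.total {x y r : W} (hx : ReflTransGen (Tau a b) x r) (hy : ReflTransGen (Tau a b) y r) :
    ReflTransGen (Tau a b) x y ∨ ReflTransGen (Tau a b) y x := by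
  have U : Relator.RightUnique (Function.swap (Tau a b)) := by
    rintro p q q' ⟨v, h1, h2⟩ ⟨v', h1', h2'⟩
    have := h2.right h2'
    subst this
    exact h1.left h1'
  have := ReflTransGen.total_of_right_unique U (reflTransGen_swap.2 hx) (reflTransGen_swap.2 hy)
  rcases this with h | h
  · exact Or.inr (reflTransGen_swap.1 h)
  · exact Or.inl (reflTransGen_swap.1 h)

lemma wf_of_acyc {W : Type} [Finite W] {R : W → W → Prop} (h : ∀ w, ¬ TransGen R w w) :
    WellFounded (Function.swap R) := by
  have : Std.Irrefl (TransGen R) := ⟨h⟩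
  have h1 : WellFounded (Function.swap (TransGen R)) := by
    have : Std.Irrefl (Function.swap (TransGen R)) := ⟨h⟩
    have : IsTrans W (Function.swap (TransGen R)) := ⟨fun x y z hx hy => TransGen.trans hy hx⟩
    exact Finite.wellFounded_of_trans_of_irrefl _
  exact Subrelation.wf (r := Function.swap (TransGen R)) (fun {x y} (hxy : R y x) => TransGen.single hxy) h1

include hA in
lemma exRoot [Fintype W] (x : W) : ∃ r, ReflTransGen (Tau a b) x r ∧ ∀ v, ¬ Tau a b r v := by
  have wf := wf_of_acyc hA
  induction x using wf.induction with
  | _ x ih =>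
    by_cases h : ∃ v, Tau a b x v
    · obtain ⟨v, hv⟩ := h
      obtain ⟨r, hr, hr'⟩ := ih v hv.ra
      exact ⟨r, hr.head hv, hr'⟩
    · push Not at h
      exact ⟨x, .refl, h⟩

variable (s : Fin n → W) (has : ∀ i, a (s i) = i) (hbs : ∀ i, b (s i) = i)
  (hma : ∀ w, s (a w) ≤ w) (hmb : ∀ w, s (b w) ≤ w)

include hA has hbs hma hmb in
lemma exFree [Fintype W] (hn : 0 < n) : ∃ j, ∀ w, b w = j → w = s j := by
  by_contra hc
  push Not at hc
  have wf := wf_of_acyc hA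
  obtain ⟨x, ⟨i, rfl⟩, hx⟩ := wf.has_min (Set.range s) ⟨s ⟨0, hn⟩, ⟨_, rfl⟩⟩
  obtain ⟨w, hw, hws⟩ := hc i
  have hlt : s i < w := lt_of_le_of_ne (hw ▸ hmb w) (Ne.symm hws)
  obtain ⟨v, hv⟩ := Nxt.ex (b := b) (hw.trans (hbs i).symm) hlt
  refine hx (s (a v)) ⟨_, rfl⟩ ⟨v, hv, (has _).symm, lt_of_le_of_ne (hma v) ?_⟩
  intro he
  have h1 : b v = a v := by rw [← he, hbs, he]
  have h2 : b v = i := hv.1.symm.trans (hbs i)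
  rw [← h1, h2] at he
  exact absurd hv.2.1 (by rw [he]; exact lt_irrefl _)

/-- per pair bound -/
lemma pairBound [Fintype W] (hn : 0 < n) (hA : ∀ w, ¬ TransGen (RA a b) w w)
  (hB : ∀ w, ¬ TransGen (RA b a) w w) (has : ∀ i, a (s i) = i) (hbs : ∀ i, b (s i) = i)
  (hma : ∀ w, s (a w) ≤ w) (hmb : ∀ w, s (b w) ≤ w) : ∃ i₀ j₀ : Fin n, ∀ i j,
    2 * (Finset.univ.filter (fun w => a w = i ∧ b w = j ∧ w ∉ Set.range s)).card
      + (if i = j then 1 else 0) + 1 ≤ n + (if i = i₀ ∧ j = j₀ then 1 else 0) := by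
  classical
  have hne : (Finset.univ : Finset W).Nonempty := ⟨s ⟨0, hn⟩, Finset.mem_univ _⟩
  obtain ⟨m, -, hm⟩ := Finset.exists_max_image Finset.univ (id : W → W) hne
  replace hm : ∀ x, x ≤ m := fun x => hm x (Finset.mem_univ _)
  choose root hroot hterm using exRoot (W := W) hA
  have hterm' : ∀ x v, ¬ Nxt b (root x) v := by
    intro x v hv
    by_cases hs : v = s (a v)
    · have h1 : b v = a v := by rw [hs, hbs, ← hs]
      have h2 : s (b (root x)) = v := by rw [hv.1, h1, ← hs]
      exact absurd (h2 ▸ hmb (root x)) (not_le.2 hv.2.1)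
    · obtain ⟨w, hw⟩ := Nxt.ex' (b := a) (has (a v)) (lt_of_le_of_ne (hma v) (Ne.symm hs))
      exact hterm x w ⟨v, hv, hw⟩
  have binj : ∀ x y, b (root x) = b (root y) → root x = root y := by
    intro x y h
    rcases lt_trichotomy (root x) (root y) with hl | hl | hl
    · obtain ⟨v, hv⟩ := Nxt.ex h.symm hl
      exact absurd hv (hterm' _ _)
    · exact hl
    · obtain ⟨v, hv⟩ := Nxt.ex h hl
      exact absurd hv (hterm' _ _)
  have tot : ∀ x y, b (root x) = b (root y) →
      ReflTransGen (Tau a b) x y ∨ ReflTransGen (Tau a b) y x := by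
    intro x y h
    exact Tau.total (hroot x) (binj x y h ▸ hroot y)
  have prevex : ∀ v, ∃ w, v ∉ Set.range s → Nxt a w v := by
    intro v
    by_cases hv : v ∈ Set.range s
    · exact ⟨v, fun h => absurd hv h⟩
    · obtain ⟨w, hw⟩ := Nxt.ex' (b := a) (has (a v))
        (lt_of_le_of_ne (hma v) (fun h => hv ⟨_, h⟩))
      exact ⟨w, fun _ => hw⟩
  choose prev hprev using prevex
  have mlast : ∀ x, b (root x) = b (root m) → x = m := by
    intro x h
    rcases tot x m h with h | h
    · rcases ReflTransGen.cases_tail h with h1 | ⟨z, hz, w, h1, h2⟩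
      · exact h1.symm
      · exact absurd h2.2.1 (not_lt.2 (hm _))
    · rcases ReflTransGen.cases_head h with h1 | ⟨z, ⟨w, h1, h2⟩, hz⟩
      · exact h1.symm
      · exact absurd h1.2.1 (not_lt.2 (hm _))
  refine ⟨a m, b m, fun i j => ?_⟩
  set D := Finset.univ.filter (fun w => a w = i ∧ b w = j) with hD
  set V := Finset.univ.filter (fun w => a w = i ∧ b w = j ∧ w ∉ Set.range s) with hV
  have cD : D.card = V.card + (if i = j then 1 else 0) := by
    by_cases hij : i = j
    · subst hij
      have : D = insert (s i) V := by
        ext w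
        simp only [hD, hV, Finset.mem_filter, Finset.mem_univ, true_and, Finset.mem_insert]
        constructor
        · rintro ⟨h1, h2⟩
          by_cases hw : w ∈ Set.range s
          · obtain ⟨k, rfl⟩ := hw
            left; rw [has] at h1; rw [h1]
          · exact Or.inr ⟨h1, h2, hw⟩
        · rintro (h | h)
          · subst h; exact ⟨has _, hbs _⟩
          · exact ⟨h.1, h.2.1⟩
      rw [this, Finset.card_insert_of_notMem]
      · simp
      · simp [hV]
    · have : D = V := by
        ext w
        simp only [hD, hV, Finset.mem_filter, Finset.mem_univ, true_and]
        constructor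
        · rintro ⟨h1, h2⟩
          refine ⟨h1, h2, ?_⟩
          rintro ⟨k, rfl⟩
          rw [has] at h1; rw [hbs] at h2; exact hij (h1.symm.trans h2)
        · rintro h; exact ⟨h.1, h.2.1⟩
      rw [this]; simp [hij]
  let f : W → Fin n := fun x => b (root x)
  let g : W → Fin n := fun x => b (root (prev x))
  have injf : Set.InjOn f D := by
    intro x hx y hy h
    simp only [hD, Finset.coe_filter, Finset.mem_univ, true_and, Set.mem_ofPred_eq] at hx hy
    rcases tot x y h with h | h
    · exact oneDD hA hB h (hx.1.trans hy.1.symm) (hx.2.trans hy.2.symm)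
    · exact (oneDD hA hB h (hy.1.trans hx.1.symm) (hy.2.trans hx.2.symm)).symm
  have injg : Set.InjOn g V := by
    intro x hx y hy h
    simp only [hV, Finset.coe_filter, Finset.mem_univ, true_and, Set.mem_ofPred_eq] at hx hy
    have px := hprev x hx.2.2
    have py := hprev y hy.2.2
    rcases tot _ _ h with h | h
    · exact oneVV hA hB h px py (hx.1.trans hy.1.symm) (hx.2.1.trans hy.2.1.symm)
    · exact (oneVV hA hB h py px (hy.1.trans hx.1.symm) (hy.2.1.trans hx.2.1.symm)).symm
  have disj : Disjoint (D.image f) (V.image g) := by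
    rw [Finset.disjoint_left]
    intro k h1 h2
    obtain ⟨x, hx, rfl⟩ := Finset.mem_image.1 h1
    obtain ⟨y, hy, h⟩ := Finset.mem_image.1 h2
    simp only [hV, hD, Finset.mem_filter, Finset.mem_univ, true_and] at hx hy
    have py := hprev y hy.2.2
    have ea := hy.1.trans hx.1.symm
    have eb := hy.2.1.trans hx.2.symm
    rcases tot _ _ h with h | h
    · exact oneVD hA hB h py ea eb
    · by_cases hxy : x = prev y
      · subst hxy
        exact oneVD hA hB .refl py ea eb
      · exact oneDV hA hB h hxy py ea.symm eb.symm
  have cU : (D.image f ∪ V.image g).card = 2 * V.card + (if i = j then 1 else 0) := by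
    rw [Finset.card_union_of_disjoint disj, Finset.card_image_of_injOn injf,
      Finset.card_image_of_injOn injg, cD]; ring
  rw [← cU]
  by_cases hp : i = a m ∧ j = b m
  · have := Finset.card_le_univ (D.image f ∪ V.image g)
    rw [Fintype.card_fin] at this
    rw [if_pos hp]; omega
  · rw [if_neg hp]
    have hnm : f m ∉ (D.image f ∪ V.image g) := by
      intro h
      rcases Finset.mem_union.1 h with h | h
      · obtain ⟨x, hx, h⟩ := Finset.mem_image.1 h
        have := mlast x h
        subst this
        simp only [hD, Finset.mem_filter, Finset.mem_univ, true_and] at hx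
        exact hp ⟨hx.1.symm, hx.2.symm⟩
      · obtain ⟨x, hx, h⟩ := Finset.mem_image.1 h
        have h3 := mlast _ h
        simp only [hV, Finset.mem_filter, Finset.mem_univ, true_and] at hx
        have := (hprev x hx.2.2).2.1
        rw [h3] at this
        exact absurd this (not_lt.2 (hm _))
    have := Finset.card_le_univ (insert (f m) (D.image f ∪ V.image g))
    rw [Fintype.card_fin, Finset.card_insert_of_notMem hnm] at this
    omega

lemma arith (n : ℕ) (hn : 0 < n) (c : Fin n → Fin n → ℕ) (i₀ j₀ i₁ j₁ : Fin n)
    (h : ∀ i j, 2 * c i j + (if i = j then 1 else 0) + 1 ≤ n + (if i = i₀ ∧ j = j₀ then 1 else 0))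
    (h1 : ∀ j, c i₁ j = 0) (h2 : ∀ i, c i j₁ = 0) :
    ∑ i, ∑ j, c i j ≤ (n + 1) / 2 * (n ^ 2 + 5 - 4 * n) := by
  classical
  set A := (Finset.univ : Finset (Fin n)).erase i₁ with hA
  set B := (Finset.univ : Finset (Fin n)).erase j₁ with hB
  have cA : A.card = n - 1 := by simp [hA]
  have cB : B.card = n - 1 := by simp [hB]
  have e1 : ∑ i, ∑ j, c i j = ∑ i ∈ A, ∑ j ∈ B, c i j := by
    rw [← Finset.add_sum_erase _ _ (Finset.mem_univ i₁)]
    rw [Finset.sum_eq_zero (fun j _ => h1 j), zero_add]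
    refine Finset.sum_congr rfl (fun i _ => ?_)
    rw [← Finset.add_sum_erase _ _ (Finset.mem_univ j₁), h2, zero_add]
  have s1 : ∑ i ∈ A, ∑ j ∈ B, (if i = i₀ ∧ j = j₀ then (1:ℤ) else 0) ≤ 1 := by
    rw [← Finset.sum_product']
    have : ∀ x : Fin n × Fin n, (if x.1 = i₀ ∧ x.2 = j₀ then (1:ℤ) else 0)
        = if x = (i₀, j₀) then 1 else 0 := by
      intro x; simp [Prod.ext_iff]
    simp only [this]
    rw [Finset.sum_ite_eq']
    split_ifs <;> norm_num
  have s2 : (n : ℤ) - 2 ≤ ∑ i ∈ A, ∑ j ∈ B, (if i = j then (1:ℤ) else 0) := by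
    simp only [Finset.sum_ite_eq]
    rw [Finset.sum_boole]
    have : A.filter (· ∈ B) = ((Finset.univ : Finset (Fin n)).erase i₁).erase j₁ := by
      ext x; simp [hA, hB, and_comm]
    rw [this]
    have := Finset.pred_card_le_card_erase (s := (Finset.univ : Finset (Fin n)).erase i₁) (a := j₁)
    rw [← hA, cA] at this
    rw [← hA]
    omega
  have key : ((n:ℤ) - 1) ^ 2 = ((A.card : ℤ) * B.card) := by
    rw [cA, cB]; push_cast [Nat.cast_sub hn]; ring
  have hsub : 4 * n ≤ n ^ 2 + 5 := by nlinarith [sq_nonneg ((n:ℤ) - 2)]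
  rw [e1]
  zify [hsub]
  rcases Nat.even_or_odd' n with ⟨q, hq | hq⟩
  · have hc : ∀ i j, (c i j : ℤ) ≤ (q - 1) + (if i = i₀ ∧ j = j₀ then (1:ℤ) else 0) := by
      intro i j
      have := h i j
      split_ifs at this ⊢ <;> omega
    have := Finset.sum_le_sum (fun i (_ : i ∈ A) => Finset.sum_le_sum (fun j (_ : j ∈ B) => hc i j))
    simp only [Finset.sum_add_distrib, Finset.sum_const, nsmul_eq_mul] at this
    have hq2 : ((n:ℤ) + 1) / 2 = q := by omega
    rw [← mul_assoc, ← key] at this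
    rw [hq2]
    have hq' : (n:ℤ) = 2 * q := by omega
    rw [hq'] at this ⊢
    nlinarith
  · have hc : ∀ i j, (c i j : ℤ) ≤ (q : ℤ) + (if i = i₀ ∧ j = j₀ then (1:ℤ) else 0)
        - (if i = j then (1:ℤ) else 0) := by
      intro i j
      have := h i j
      split_ifs at this ⊢ <;> omega
    have := Finset.sum_le_sum (fun i (_ : i ∈ A) => Finset.sum_le_sum (fun j (_ : j ∈ B) => hc i j))
    simp only [Finset.sum_add_distrib, Finset.sum_sub_distrib, Finset.sum_const, nsmul_eq_mul]
      at this
    have hq2 : ((n:ℤ) + 1) / 2 = q + 1 := by omega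
    rw [← mul_assoc, ← key] at this
    rw [hq2]
    have hq' : (n:ℤ) = 2 * q + 1 := by omega
    rw [hq'] at this s2 ⊢
    nlinarith

theorem count [Fintype W] (hn : 0 < n) (hA : ∀ w, ¬ TransGen (RA a b) w w)
  (hB : ∀ w, ¬ TransGen (RA b a) w w) (has : ∀ i, a (s i) = i) (hbs : ∀ i, b (s i) = i)
  (hma : ∀ w, s (a w) ≤ w) (hmb : ∀ w, s (b w) ≤ w) :
    {w : W | w ∉ Set.range s}.ncard ≤ (n + 1) / 2 * (n ^ 2 + 5 - 4 * n) := by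
  classical
  obtain ⟨i₀, j₀, h⟩ := pairBound s hn hA hB has hbs hma hmb
  obtain ⟨j₁, hj⟩ := exFree hA s has hbs hma hmb hn
  obtain ⟨i₁, hi⟩ := exFree hB s hbs has hmb hma hn
  have := arith n hn (fun i j =>
    (Finset.univ.filter (fun w => a w = i ∧ b w = j ∧ w ∉ Set.range s)).card) i₀ j₀ i₁ j₁ h ?_ ?_
  · refine le_trans (le_of_eq ?_) this
    have e : {w : W | w ∉ Set.range s} = ((Finset.univ.filter (fun w => w ∉ Set.range s) : Finset W) : Set W) := by
      ext; simp
    rw [e, Set.ncard_coe_finset]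
    rw [Finset.card_eq_sum_card_fiberwise (f := a) (t := Finset.univ) (by intro x _; simp)]
    refine Finset.sum_congr rfl (fun i _ => ?_)
    rw [Finset.card_eq_sum_card_fiberwise (f := b) (t := Finset.univ) (by intro x _; simp)]
    refine Finset.sum_congr rfl (fun j _ => ?_)
    congr 1
    ext w
    simp only [Finset.mem_filter, Finset.mem_univ, true_and]
    tauto
  · intro j
    simp only [Finset.card_eq_zero, Finset.filter_eq_empty_iff]
    rintro w - ⟨h1, h2, h3⟩
    exact h3 ⟨_, (hi w h1).symm⟩
  · intro i
    simp only [Finset.card_eq_zero, Finset.filter_eq_empty_iff]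
    rintro w - ⟨h1, h2, h3⟩
    exact h3 ⟨_, (hj w h2).symm⟩

end comb

section reroute

lemma exZ {W : Type} [Finite W] {R : W → W → Prop} {w : W} (h : TransGen R w w) :
    ∃ Z : Set W, Z.Nonempty ∧ (∀ z ∈ Z, ∃ z' ∈ Z, R z z') ∧ (∀ z ∈ Z, ∃ z' ∈ Z, R z' z) ∧
      (∀ z ∈ Z, ∀ x ∈ Z, ∀ y ∈ Z, R z x → R z y → x = y) ∧
      (∀ z ∈ Z, ∀ x ∈ Z, ∀ y ∈ Z, R x z → R y z → x = y) := by
  classical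
  have := Fintype.ofFinite W
  let C : Set (Finset W) := {Z | Z.Nonempty ∧ ∀ z ∈ Z, ∃ z' ∈ Z, R z z'}
  have hC : C.Nonempty := by
    refine ⟨Finset.univ.filter (fun x => TransGen R w x ∧ TransGen R x w), ⟨w, by simp [h]⟩, ?_⟩
    intro z hz
    simp only [Finset.mem_filter, Finset.mem_univ, true_and] at hz ⊢
    obtain ⟨y, hy, hyw⟩ := TransGen.head'_iff.1 hz.2
    refine ⟨y, ⟨hz.1.tail hy, ?_⟩, hy⟩
    rcases reflTransGen_iff_eq_or_transGen.1 hyw with h1 | h1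
    · subst h1; exact h
    · exact h1
  obtain ⟨Z, ⟨hne, hcl⟩, hmin⟩ := (measure (Finset.card : Finset W → ℕ)).wf.has_min C hC
  have key : ∀ f : W → W, (∀ z ∈ Z, f z ∈ Z ∧ R z (f z)) → Z.image f = Z ∧ Set.InjOn f Z := by
    intro f hf
    have hsub : Z.image f ⊆ Z := by
      intro x hx
      obtain ⟨y, hy, rfl⟩ := Finset.mem_image.1 hx
      exact (hf y hy).1
    have hin : Z.image f ∈ C := by
      refine ⟨hne.image f, ?_⟩
      intro x hx
      exact ⟨f x, Finset.mem_image_of_mem f (hsub hx), (hf x (hsub hx)).2⟩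
    have hcard : Z.card ≤ (Z.image f).card := not_lt.1 (hmin _ hin)
    have heq := Finset.eq_of_subset_of_card_le hsub hcard
    refine ⟨heq, Finset.injOn_of_card_image_eq (by rw [heq])⟩
  choose! f hf using hcl
  have hf' : ∀ z ∈ Z, f z ∈ Z ∧ R z (f z) := hf
  obtain ⟨hfi, hfinj⟩ := key f hf'
  have uni : ∀ z ∈ Z, ∀ x ∈ Z, R z x → x = f z := by
    intro z hz x hx hzx
    obtain ⟨hgi, hginj⟩ := key (Function.update f z x) (by
      intro y hy
      by_cases hyz : y = z
      · subst hyz; simp [hx, hzx]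
      · simp [hyz, hf' y hy])
    have : f z ∈ Z.image (Function.update f z x) := by rw [hgi]; exact (hf' z hz).1
    obtain ⟨y, hy, hyf⟩ := Finset.mem_image.1 this
    by_cases hyz : y = z
    · subst hyz; simpa using hyf
    · simp only [Function.update_of_ne hyz] at hyf
      exact absurd (hfinj hy hz hyf) hyz
  refine ⟨Z, hne, fun z hz => ⟨f z, hf' z hz⟩, ?_, ?_, ?_⟩
  · intro z hz
    have hz' : z ∈ Z.image f := by rw [hfi]; exact hz
    obtain ⟨y, hy, rfl⟩ := Finset.mem_image.1 hz'
    exact ⟨y, hy, (hf' y hy).2⟩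
  · intro z hz x hx y hy h1 h2
    rw [uni z hz x hx h1, uni z hz y hy h2]
  · intro z hz x hx y hy h1 h2
    exact hfinj hx hy ((uni x hx z hz h1).symm.trans (uni y hy z hz h2))

variable {E : Type} {n : ℕ}

def Mem (s : Fin n → E) (P : E → E → Prop) (x : E) : Prop := x ∈ Set.range s ∨ ∃ w, P w x

structure PS (adj : E → E → Prop) (s : Fin n → E) (T : E → Prop) (P : E → E → Prop) : Prop where
  adj : ∀ x y, P x y → adj x y
  left : ∀ x x' y, P x y → P x' y → x = x'
  right : ∀ x y y', P x y → P x y' → y = y'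
  start : ∀ x i, ¬ P x (s i)
  mem : ∀ x y, P x y → Mem s P x
  fin : ∀ x, Mem s P x → (∃ y, P x y) ∨ T x

structure Idx [LinearOrder E] (s : Fin n → E) (P : E → E → Prop) (a : E → Fin n) : Prop where
  as : ∀ i, a (s i) = i
  aP : ∀ x y, P x y → a x = a y
  amin : ∀ x, Mem s P x → s (a x) ≤ x
  pred : ∀ x y, Mem s P x → Mem s P y → a x = a y → x < y → ∃ z, P z y ∧ x ≤ z
  succ : ∀ x y, Mem s P x → Mem s P y → a x = a y → x < y → ∃ z, P x z ∧ z ≤ y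

variable [LinearOrder E] [Fintype E] {adj : E → E → Prop} (hlt : ∀ x y, adj x y → x < y)
  {s : Fin n → E} {T : E → Prop}

include hlt in
lemma PS.le {P : E → E → Prop} (h : PS adj s T P) {x y : E}
    (hr : ReflTransGen P x y) : x ≤ y := by
  induction hr with
  | refl => exact le_rfl
  | tail _ h2 ih => exact ih.trans (hlt _ _ (h.adj _ _ h2)).le

include hlt in
lemma PS.idx (hn : 0 < n) (hs : Function.Injective s) {P : E → E → Prop} (h : PS adj s T P) :
    ∃ a, Idx s P a ∧ ∀ i x, ReflTransGen P (s i) x → a x = i := by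
  classical
  have ex : ∀ x, Mem s P x → ∃ i, ReflTransGen P (s i) x := by
    intro x
    induction x using (wellFounded_lt (α := E)).induction with
    | _ x ih =>
      rintro (⟨i, rfl⟩ | ⟨w, hw⟩)
      · exact ⟨i, .refl⟩
      · obtain ⟨i, hi⟩ := ih w (hlt _ _ (h.adj _ _ hw)) (h.mem _ _ hw)
        exact ⟨i, hi.tail hw⟩
  have ex' : ∀ x, ∃ i, Mem s P x → ReflTransGen P (s i) x := by
    intro x
    by_cases hx : Mem s P x
    · obtain ⟨i, hi⟩ := ex x hx; exact ⟨i, fun _ => hi⟩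
    · exact ⟨⟨0, hn⟩, fun h => absurd h hx⟩
  choose a ha using ex'
  have U1 : Relator.RightUnique P := fun x y y' => h.right x y y'
  have U2 : Relator.RightUnique (Function.swap P) := fun y x x' => h.left x x' y
  have tos : ∀ x i, ReflTransGen P x (s i) → x = s i := by
    intro x i hx
    rcases ReflTransGen.cases_tail hx with h1 | ⟨z, _, hz⟩
    · exact h1.symm
    · exact absurd hz (h.start _ _)
  have memr : ∀ i x, ReflTransGen P (s i) x → Mem s P x := by
    intro i x hx
    rcases ReflTransGen.cases_tail hx with h1 | ⟨z, _, hz⟩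
    · exact Or.inl ⟨i, h1.symm⟩
    · exact Or.inr ⟨z, hz⟩
  have uni : ∀ i x, ReflTransGen P (s i) x → a x = i := by
    intro i x hx
    have h1 := ha x (memr i x hx)
    rcases ReflTransGen.total_of_right_unique U2 (reflTransGen_swap.2 hx)
      (reflTransGen_swap.2 h1) with h2 | h2
    · exact hs (tos _ _ (reflTransGen_swap.1 h2))
    · exact (hs (tos _ _ (reflTransGen_swap.1 h2))).symm
  have cmp : ∀ x y, Mem s P x → Mem s P y → a x = a y → x < y → ReflTransGen P x y := by
    intro x y hx hy hxy hl
    have h1 := ha x hx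
    have h2 := ha y hy
    rw [← hxy] at h2
    rcases ReflTransGen.total_of_right_unique U1 h1 h2 with h3 | h3
    · exact h3
    · exact absurd (h.le hlt h3) (not_le.2 hl)
  refine ⟨a, ⟨?_, ?_, ?_, ?_, ?_⟩, uni⟩
  · intro i; exact uni i _ .refl
  · intro x y hxy
    exact (uni _ _ ((ha x (h.mem _ _ hxy)).tail hxy)).symm
  · intro x hx; exact h.le hlt (ha x hx)
  · intro x y hx hy hxy hl
    rcases ReflTransGen.cases_tail (cmp x y hx hy hxy hl) with h1 | ⟨z, hz, hzy⟩
    · exact absurd hl (by rw [h1]; exact lt_irrefl _)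
    · exact ⟨z, hzy, h.le hlt hz⟩
  · intro x y hx hy hxy hl
    rcases ReflTransGen.cases_head (cmp x y hx hy hxy hl) with h1 | ⟨z, hxz, hz⟩
    · exact absurd hl (by rw [h1]; exact lt_irrefl _)
    · exact ⟨z, hxz, h.le hlt hz⟩

include hlt in
lemma reroute {P Q : E → E → Prop} {T' : E → Prop} (hP : PS adj s T P) (hQ : PS adj s T' Q)
    {a b : E → Fin n} (ha : Idx s P a) (hb : Idx s Q b) (Wp : E → Prop)
    (hW : ∀ x, Wp x ↔ Mem s P x ∧ Mem s Q x ∧ (x ∈ Set.range s ∨ ¬ ∃ z, P z x ∧ Q z x))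
    (w : {x // Wp x})
    (hw : TransGen (RA (fun x : {x // Wp x} => a x.1) (fun x : {x // Wp x} => b x.1)) w w) :
    ∃ P', PS adj s T P' ∧ (∀ x y, P' x y → P x y ∨ Q x y) ∧
      ∃ x y, P x y ∧ ¬ Q x y ∧ ¬ P' x y := by
  classical
  obtain ⟨Z, hZne, hZs, hZp, uR, uL⟩ := exZ hw
  set A : {x // Wp x} → Fin n := fun x => a x.1 with hAdef
  set B : {x // Wp x} → Fin n := fun x => b x.1 with hBdef
  let K : E → Prop := fun y => Mem s Q y ∧ ∃ z ∈ Z, ∃ v, Nxt B z v ∧ b y = b z.1 ∧ z.1 < y ∧ y ≤ v.1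
  let I : E → Prop := fun y => Mem s P y ∧ ∃ z ∈ Z, ∃ z' ∈ Z, ∃ v, Nxt B z v ∧ a v.1 = a z'.1 ∧
    z'.1 < y ∧ y < v.1 ∧ a y = a z'.1
  let P' : E → E → Prop := fun x y => (K y ∧ Q x y) ∨ (¬ K y ∧ ¬ I y ∧ P x y)
  have mP : ∀ x : {x // Wp x}, Mem s P x.1 := fun x => ((hW x.1).1 x.2).1
  have mQ : ∀ x : {x // Wp x}, Mem s Q x.1 := fun x => ((hW x.1).1 x.2).2.1
  -- non start facts
  have nsQ : ∀ x y, Mem s Q x → b x = b y → x < y → Mem s Q y → ∃ z, Q z y ∧ x ≤ z :=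
    fun x y h1 h2 h3 h4 => hb.pred x y h1 h4 h2 h3
  have nstart : ∀ x y, Mem s Q x → b x = b y → x < y → y ∉ Set.range s := by
    rintro x y h1 h2 h3 ⟨i, rfl⟩
    rw [hb.as] at h2
    exact absurd (h2 ▸ hb.amin x h1) (not_le.2 h3)
  have nstartP : ∀ x y, Mem s P x → a x = a y → x < y → y ∉ Set.range s := by
    rintro x y h1 h2 h3 ⟨i, rfl⟩
    rw [ha.as] at h2
    exact absurd (h2 ▸ ha.amin x h1) (not_le.2 h3)
  have notW : ∀ z v : {x // Wp x}, Nxt B z v → ∀ y, b y = b z.1 → z.1 < y → y < v.1 → ¬ Wp y := by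
    intro z v hv y h1 h2 h3 h4
    exact absurd (hv.2.2 ⟨y, h4⟩ h1 h2) (not_le.2 h3)
  have agree : ∀ z v : {x // Wp x}, Nxt B z v → ∀ y, Mem s P y → Mem s Q y → b y = b z.1 →
      z.1 < y → y < v.1 → ∃ x, P x y ∧ Q x y := by
    intro z v hv y h1 h2 h3 h4 h5
    have := notW z v hv y h3 h4 h5
    rw [hW] at this
    by_contra hc
    exact this ⟨h1, h2, Or.inr hc⟩
  have block : ∀ z v : {x // Wp x}, Nxt B z v → ∀ y, Mem s P y → Mem s Q y → b y = b z.1 →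
      z.1 ≤ y → y < v.1 → a y = a z.1 ∧ ∀ u, Wp u → a u = a z.1 → z.1 < u → ¬ u ≤ y := by
    intro z v hv y
    induction y using (wellFounded_lt (α := E)).induction with
    | _ y ih =>
      intro h1 h2 h3 h4 h5
      rcases eq_or_lt_of_le h4 with h6 | h6
      · rw [← h6]
        exact ⟨rfl, fun u _ _ h7 h8 => absurd h7 (not_lt.2 h8)⟩
      · obtain ⟨x, hx, hx'⟩ := agree z v hv y h1 h2 h3 h6 h5
        obtain ⟨x2, hx2, hzx⟩ := hb.pred z.1 y (mQ z) h2 h3.symm h6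
        have := hQ.left _ _ _ hx2 hx'
        subst this
        have hxy := hlt _ _ (hP.adj _ _ hx)
        obtain ⟨i1, i2⟩ := ih x2 hxy (hP.mem _ _ hx) (hQ.mem _ _ hx')
          ((hb.aP _ _ hx').trans h3) hzx (hxy.trans h5)
        have e := ha.aP _ _ hx
        refine ⟨e.symm.trans i1, ?_⟩
        intro u hu hau hzu huy
        rcases eq_or_lt_of_le huy with h7 | h7
        · subst h7; exact notW z v hv u h3 hzu h5 hu
        · obtain ⟨x3, hx3, hux⟩ := ha.pred u y ((hW u).1 hu).1 h1 (hau.trans (i1.symm.trans e)) h7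
          have := hP.left _ _ _ hx3 hx
          subst this
          exact i2 u hu hau hzu hux
  have Kv : ∀ z ∈ Z, ∀ v, Nxt B z v → K v.1 := by
    intro z hz v hv
    exact ⟨mQ v, z, hz, v, hv, hv.1.symm, hv.2.1, le_rfl⟩
  have Iz : ∀ z ∈ Z, ¬ I z.1 := by
    rintro z hz ⟨_, z1, hz1, z', hz', v, hv, h1, h2, h3, h4⟩
    have := uR z1 hz1 z hz z' hz' ⟨v, hv, h1.trans h4.symm, h3⟩ ⟨v, hv, h1, h2.trans h3⟩
    subst this
    exact lt_irrefl _ h2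
  have Iv : ∀ z ∈ Z, ∀ v, Nxt B z v → ¬ I v.1 := by
    rintro z hz v hv ⟨_, z1, hz1, z', hz', v1, hv1, h1, h2, h3, h4⟩
    have := uL z' hz' z hz z1 hz1 ⟨v, hv, h4, h2⟩ ⟨v1, hv1, h1, h2.trans h3⟩
    subst this
    have := hv.right hv1
    subst this
    exact lt_irrefl _ h3
  have Is : ∀ i, ¬ I (s i) := by
    rintro i ⟨_, z1, hz1, z', hz', v, hv, h1, h2, h3, h4⟩
    exact nstartP _ _ (mP z') h4.symm h2 ⟨i, rfl⟩
  have Ks : ∀ i, ¬ K (s i) := by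
    rintro i ⟨_, z, hz, v, hv, h1, h2, h3⟩
    exact nstart _ _ (mQ z) h1.symm h2 ⟨i, rfl⟩
  have Kpred : ∀ x y, K y → Q x y → ∃ z ∈ Z, ∃ v, Nxt B z v ∧ b x = b z.1 ∧ z.1 ≤ x ∧ x < v.1
      ∧ Mem s Q x := by
    rintro x y ⟨my, z, hz, v, hv, h1, h2, h3⟩ hxy
    obtain ⟨x', hx', hzx⟩ := hb.pred _ _ (mQ z) my h1.symm h2
    have := hQ.left _ _ _ hx' hxy
    subst this
    exact ⟨z, hz, v, hv, (hb.aP _ _ hxy).trans h1, hzx,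
      (hlt _ _ (hQ.adj _ _ hxy)).trans_le h3, hQ.mem _ _ hxy⟩
  have memK : ∀ x, K x → Mem s P' x := by
    intro x hx
    rcases hx.1 with ⟨i, rfl⟩ | ⟨w, hw⟩
    · exact absurd hx (Ks i)
    · exact Or.inr ⟨w, Or.inl ⟨hx, hw⟩⟩
  have memI : ∀ x, Mem s P x → ¬ I x → Mem s P' x := by
    intro x hx hI
    by_cases hK : K x
    · exact memK x hK
    · rcases hx with hx | ⟨w, hw⟩
      · exact Or.inl hx
      · exact Or.inr ⟨w, Or.inr ⟨hK, hI, hw⟩⟩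
  have mixed : ∀ x y y', K y → Q x y → ¬ K y' → ¬ I y' → P x y' → False := by
    intro x y y' hK hQx hK' hI' hPx
    obtain ⟨z, hz, v, hv, h1, h2, h3, h4⟩ := Kpred x y hK hQx
    obtain ⟨b1, b2⟩ := block z v hv x (hP.mem _ _ hPx) h4 h1 h2 h3
    obtain ⟨z1, hz1, v1, hv1, h5, h6⟩ := hZp z hz
    have hxy := hlt _ _ (hP.adj _ _ hPx)
    have hmy : Mem s P y' := Or.inr ⟨x, hPx⟩
    have hay : a y' = a z.1 := (ha.aP _ _ hPx).symm.trans b1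
    have h7 : v1.1 ≤ y' := by
      by_contra hc
      push Not at hc
      exact hI' ⟨hmy, z1, hz1, z, hz, v1, hv1, h5, h2.trans_lt hxy, hc, hay⟩
    rcases eq_or_lt_of_le h7 with h8 | h8
    · exact hK' (h8 ▸ Kv z1 hz1 v1 hv1)
    · obtain ⟨x', hx', h9⟩ := ha.pred v1.1 y' (mP v1) hmy (h5.trans hay.symm) h8
      have := hP.left _ _ _ hx' hPx
      subst this
      exact b2 v1.1 v1.2 h5 h6 h9
  have E1 : ∀ z ∈ Z, ∀ v, Nxt B z v → ∀ x, Mem s Q x → b x = b z.1 → z.1 ≤ x → x < v.1 →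
      ∃ y, P' x y := by
    intro z hz v hv x hx h1 h2 h3
    obtain ⟨y, hxy, hyv⟩ := hb.succ x v.1 hx (mQ v) (h1.trans hv.1) h3
    exact ⟨y, Or.inl ⟨⟨Or.inr ⟨x, hxy⟩, z, hz, v, hv, (hb.aP _ _ hxy).symm.trans h1,
      h2.trans_lt (hlt _ _ (hQ.adj _ _ hxy)), hyv⟩, hxy⟩⟩
  have E2 : ∀ z ∈ Z, ∃ y, P' z.1 y := by
    intro z hz
    obtain ⟨z', hz', v, hv, -, -⟩ := hZs z hz
    exact E1 z hz v hv z.1 (mQ z) rfl le_rfl hv.2.1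
  refine ⟨P', ⟨?_, ?_, ?_, ?_, ?_, ?_⟩, ?_, ?_⟩
  · rintro x y (h | h)
    · exact hQ.adj _ _ h.2
    · exact hP.adj _ _ h.2.2
  · rintro x x' y (h | h) (h' | h')
    · exact hQ.left _ _ _ h.2 h'.2
    · exact absurd h.1 h'.1
    · exact absurd h'.1 h.1
    · exact hP.left _ _ _ h.2.2 h'.2.2
  · rintro x y y' (h | h) (h' | h')
    · exact hQ.right _ _ _ h.2 h'.2
    · exact (mixed x y y' h.1 h.2 h'.1 h'.2.1 h'.2.2).elim
    · exact (mixed x y' y h'.1 h'.2 h.1 h.2.1 h.2.2).elim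
    · exact hP.right _ _ _ h.2.2 h'.2.2
  · rintro x i (h | h)
    · exact hQ.start _ _ h.2
    · exact hP.start _ _ h.2.2
  · rintro x y (h | h)
    · obtain ⟨z, hz, v, hv, h1, h2, h3, h4⟩ := Kpred x y h.1 h.2
      rcases eq_or_lt_of_le h2 with h5 | h5
      · rw [← h5]; exact memI _ (mP z) (Iz z hz)
      · exact memK x ⟨h4, z, hz, v, hv, h1, h5, h3.le⟩
    · obtain ⟨hK, hI, hxy⟩ := h
      refine memI x (hP.mem _ _ hxy) ?_
      rintro ⟨mx, z1, hz1, z', hz', v, hv, h1, h2, h3, h4⟩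
      have hl := hlt _ _ (hP.adj _ _ hxy)
      have e := ha.aP _ _ hxy
      have my : Mem s P y := Or.inr ⟨x, hxy⟩
      have h7 : v.1 ≤ y := by
        by_contra hc
        push Not at hc
        exact hI ⟨my, z1, hz1, z', hz', v, hv, h1, h2.trans hl, hc, e.symm.trans h4⟩
      rcases eq_or_lt_of_le h7 with h8 | h8
      · exact hK (h8 ▸ Kv z1 hz1 v hv)
      · obtain ⟨x', hx', h9⟩ := ha.pred v.1 y (mP v) my (h1.trans (h4.symm.trans e)) h8
        have := hP.left _ _ _ hx' hxy
        subst this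
        exact absurd h3 (not_lt.2 h9)
  · intro x hx
    by_contra hc
    push Not at hc
    obtain ⟨hno, hT⟩ := hc
    have nE1 : ∀ z ∈ Z, ∀ v, Nxt B z v → Mem s Q x → b x = b z.1 → z.1 ≤ x → ¬ x < v.1 := by
      intro z hz v hv h1 h2 h3 h4
      obtain ⟨y, hy⟩ := E1 z hz v hv x h1 h2 h3 h4
      exact hno y hy
    have nE2 : ∀ z ∈ Z, x ≠ z.1 := by
      rintro z hz rfl
      obtain ⟨y, hy⟩ := E2 z hz
      exact hno y hy
    have hx2 : Mem s P x ∧ ¬ I x := by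
      rcases hx with ⟨i, rfl⟩ | ⟨w, h | h⟩
      · exact ⟨Or.inl ⟨i, rfl⟩, Is i⟩
      · obtain ⟨⟨mx, z, hz, v, hv, h1, h2, h3⟩, -⟩ := h
        rcases eq_or_lt_of_le h3 with h4 | h4
        · rw [h4]; exact ⟨mP v, Iv z hz v hv⟩
        · exact absurd h4 (nE1 z hz v hv mx h1 h2.le)
      · exact ⟨Or.inr ⟨w, h.2.2⟩, h.2.1⟩
    obtain ⟨mx, nI⟩ := hx2
    rcases hP.fin x mx with ⟨y, hxy⟩ | h
    swap
    · exact hT h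
    have hl := hlt _ _ (hP.adj _ _ hxy)
    have e := ha.aP _ _ hxy
    have my : Mem s P y := Or.inr ⟨x, hxy⟩
    have nIy : ¬ I y := by
      rintro ⟨_, z1, hz1, z', hz', v, hv, h1, h2, h3, h4⟩
      obtain ⟨x', hx', h9⟩ := ha.pred z'.1 y (mP z') my h4.symm h2
      have := hP.left _ _ _ hx' hxy
      subst this
      rcases eq_or_lt_of_le h9 with h10 | h10
      · exact nE2 z' hz' h10.symm
      · exact nI ⟨mx, z1, hz1, z', hz', v, hv, h1, h10, hl.trans h3, e.trans h4⟩
    have nKy : ¬ K y := by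
      rintro ⟨mqy, z, hz, v, hv, h1, h2, h3⟩
      rcases eq_or_lt_of_le h3 with h4 | h4
      · obtain ⟨z', hz', v', hv', h5, h6⟩ := hZs z hz
        have := hv.right hv'
        subst this
        rw [h4] at e my hl
        obtain ⟨x', hx', h9⟩ := ha.pred z'.1 v.1 (mP z') my h5.symm h6
        rw [h4] at hxy
        have := hP.left _ _ _ hx' hxy
        subst this
        rcases eq_or_lt_of_le h9 with h10 | h10
        · exact nE2 z' hz' h10.symm
        · exact nI ⟨mx, z, hz, z', hz', v, hv, h5, h10, hl, e.trans h5⟩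
      · obtain ⟨x', hx', hx''⟩ := agree z v hv y my mqy h1 h2 h4
        have := hP.left _ _ _ hx' hxy
        subst this
        obtain ⟨x2, hx2, hzx⟩ := hb.pred z.1 y (mQ z) mqy h1.symm h2
        have := hQ.left _ _ _ hx2 hx''
        subst this
        exact nE1 z hz v hv (hQ.mem _ _ hx'') ((hb.aP _ _ hx'').trans h1) hzx (hl.trans h4)
    exact hno y (Or.inr ⟨nKy, nIy, hxy⟩)
  · rintro x y (h | h)
    · exact Or.inr h.2
    · exact Or.inl h.2.2
  · obtain ⟨z, hz⟩ := hZne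
    obtain ⟨z', hz', v, hv, -, -⟩ := hZs z hz
    have hns := nstart _ _ (mQ z) hv.1 hv.2.1
    have hWv := (hW v.1).1 v.2
    rcases hWv.1 with h | ⟨x, hx⟩
    · exact absurd h hns
    have hnq : ¬ Q x v.1 := by
      intro hq
      rcases hWv.2.2 with h | h
      · exact hns h
      · exact h ⟨x, hx, hq⟩
    refine ⟨x, v.1, hx, hnq, ?_⟩
    rintro (h | h)
    · exact hnq h.2
    · exact h.1 (Kv z hz v hv)

include hlt in
/-- existence of a pair of path systems with few mergings -/
theorem exGood (hn : 0 < n) (hs : Function.Injective s) {T' : E → Prop}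
    (h1 : ∃ P, PS adj s T P) (h2 : ∃ Q, PS adj s T' Q) :
    ∃ P Q, PS adj s T P ∧ PS adj s T' Q ∧
      {e : E | ∃ f g, f ≠ g ∧ P f e ∧ Q g e}.ncard ≤ (n + 1) / 2 * (n ^ 2 + 5 - 4 * n) := by
  classical
  let X : Set ((E → E → Prop) × (E → E → Prop)) := {p | PS adj s T p.1 ∧ PS adj s T' p.2}
  have hX : X.Nonempty := by
    obtain ⟨P, hP⟩ := h1
    obtain ⟨Q, hQ⟩ := h2
    exact ⟨(P, Q), hP, hQ⟩
  let μ : (E → E → Prop) × (E → E → Prop) → ℕ :=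
    fun p => {x : E × E | p.1 x.1 x.2 ∨ p.2 x.1 x.2}.ncard
  obtain ⟨⟨P, Q⟩, ⟨hP, hQ⟩, hmin⟩ := (measure μ).wf.has_min X hX
  simp only at hP hQ
  refine ⟨P, Q, hP, hQ, ?_⟩
  obtain ⟨a, ha, -⟩ := hP.idx hlt hn hs
  obtain ⟨b, hb, -⟩ := hQ.idx hlt hn hs
  let Wp : E → Prop := fun x => Mem s P x ∧ Mem s Q x ∧ (x ∈ Set.range s ∨ ¬ ∃ z, P z x ∧ Q z x)
  have hA : ∀ w, ¬ TransGen (RA (fun x : {x // Wp x} => a x.1) (fun x => b x.1)) w w := by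
    intro w hw
    obtain ⟨P', hP', hsub, x, y, e1, e2, e3⟩ := reroute hlt hP hQ ha hb Wp (fun x => Iff.rfl) w hw
    refine hmin (P', Q) ⟨hP', hQ⟩ ?_
    refine Set.ncard_lt_ncard ?_ (Set.toFinite _)
    refine (Set.ssubset_iff_of_subset ?_).2 ⟨(x, y), Or.inl e1, ?_⟩
    · rintro ⟨u, v⟩ (h | h)
      · exact hsub _ _ h
      · exact Or.inr h
    · rintro (h | h)
      · exact e3 h
      · exact e2 h
  have hB : ∀ w, ¬ TransGen (RA (fun x : {x // Wp x} => b x.1) (fun x => a x.1)) w w := by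
    intro w hw
    obtain ⟨Q', hQ', hsub, x, y, e1, e2, e3⟩ := reroute hlt hQ hP hb ha Wp (fun x => by
      simp only [Wp, and_comm (a := P _ _)]; tauto) w hw
    refine hmin (P, Q') ⟨hP, hQ'⟩ ?_
    refine Set.ncard_lt_ncard ?_ (Set.toFinite _)
    refine (Set.ssubset_iff_of_subset ?_).2 ⟨(x, y), Or.inr e1, ?_⟩
    · rintro ⟨u, v⟩ (h | h)
      · exact Or.inl h
      · exact (hsub _ _ h).symm
    · rintro (h | h)
      · exact e2 h
      · exact e3 h
  let s' : Fin n → {x // Wp x} := fun i => ⟨s i, Or.inl ⟨i, rfl⟩, Or.inl ⟨i, rfl⟩, Or.inl ⟨i, rfl⟩⟩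
  have := count s' hn hA hB (fun i => ha.as i) (fun i => hb.as i)
    (fun w => ha.amin w.1 w.2.1) (fun w => hb.amin w.1 w.2.2.1)
  refine le_trans ?_ this
  rw [← Set.ncard_image_of_injective _ Subtype.val_injective]
  refine Set.ncard_le_ncard ?_ (Set.toFinite _)
  rintro e ⟨f, g, hfg, h3, h4⟩
  refine ⟨⟨e, Or.inr ⟨f, h3⟩, Or.inr ⟨g, h4⟩, Or.inr ?_⟩, ?_, rfl⟩
  · rintro ⟨z, h5, h6⟩
    exact hfg ((hP.left _ _ _ h3 h5).trans (hQ.left _ _ _ h6 h4))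
  · rintro ⟨i, hi⟩
    have : s i = e := congrArg Subtype.val hi
    subst this
    exact hP.start _ _ h3

end reroute

section graph

def LAdj (G : MultiDigraph) (n : ℕ) (S : G.V) : Fin n ⊕ G.E → Fin n ⊕ G.E → Prop
  | .inl _, .inr e => G.src e = S
  | .inr e, .inr f => G.dst e = G.src f
  | _, .inl _ => False

def LT (G : MultiDigraph) (n : ℕ) (R : G.V) : Fin n ⊕ G.E → Prop
  | .inl _ => False
  | .inr e => G.dst e = R

variable {G : MultiDigraph} {n : ℕ} {S : G.V}

lemma ladj_tgt {x : Fin n ⊕ G.E} {y : Fin n ⊕ G.E} (h : LAdj G n S x y) : ∃ e, y = .inr e := by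
  rcases y with i | e
  · rcases x with j | f <;> exact absurd h (by simp [LAdj])
  · exact ⟨e, rfl⟩

lemma path_cons {u v : G.V} {p : List G.E} {e : G.E} (h : G.IsPathFrom u v p) (he : G.dst e = u) :
    G.IsPathFrom (G.src e) v (e :: p) := by
  obtain ⟨h1, h2, h3, h4⟩ := h
  refine ⟨by simp, ?_, by simp, ?_⟩
  · refine List.isChain_cons.2 ⟨?_, h2⟩
    intro y hy
    rw [he, h3 y hy]
  · intro x hx
    rw [List.getLast?_cons_of_ne_nil h1] at hx
    exact h4 x hx

lemma trans_path {x : Fin n ⊕ G.E} {f : G.E} (h : TransGen (LAdj G n S) x (.inr f)) :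
    ∀ e, x = .inr e → ∃ p, G.IsPathFrom (G.src e) (G.src f) p := by
  induction h using TransGen.head_induction_on with
  | single h =>
    rintro e rfl
    refine ⟨[e], by simp, List.isChain_singleton _, by simp, ?_⟩
    simpa [LAdj] using h
  | head h _ ih =>
    rintro e rfl
    obtain ⟨g, rfl⟩ := ladj_tgt h
    obtain ⟨p, hp⟩ := ih g rfl
    exact ⟨e :: p, path_cons hp h⟩

lemma ladj_acyc (hG : G.Acyclic) (x : Fin n ⊕ G.E) : ¬ TransGen (LAdj G n S) x x := by
  intro h
  obtain ⟨y, -, hy⟩ := TransGen.tail'_iff.1 h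
  obtain ⟨e, rfl⟩ := ladj_tgt hy
  obtain ⟨p, hp⟩ := trans_path h e rfl
  exact hG _ _ hp

lemma exLin (hG : G.Acyclic) : ∃ _ : LinearOrder (Fin n ⊕ G.E),
    ∀ x y : Fin n ⊕ G.E, LAdj G n S x y → x < y := by
  classical
  have hp : IsPartialOrder (Fin n ⊕ G.E) (ReflTransGen (LAdj G n S)) :=
    { refl := fun _ => .refl
      trans := fun _ _ _ => ReflTransGen.trans
      antisymm := by
        intro x y h1 h2
        rcases reflTransGen_iff_eq_or_transGen.1 h1 with h | h
        · exact h.symm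
        · exact absurd (h.trans_left h2) (ladj_acyc hG x) }
  obtain ⟨r, hr, hsub⟩ := extend_partialOrder (ReflTransGen (LAdj G n S))
  let L : LinearOrder (Fin n ⊕ G.E) :=
    { le := r
      le_refl := hr.refl
      le_trans := fun a b c => hr.trans a b c
      le_antisymm := fun a b => hr.antisymm a b
      le_total := hr.total
      toDecidableLE := Classical.decRel _ }
  refine ⟨L, fun x y h => ?_⟩
  have h1 : x ≤ y := hsub _ _ (ReflTransGen.single h)
  refine lt_of_le_of_ne h1 ?_
  rintro rfl
  exact ladj_acyc hG x (TransGen.single h)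

lemma toPS [LinearOrder (Fin n ⊕ G.E)] (hlt : ∀ x y : Fin n ⊕ G.E, LAdj G n S x y → x < y)
    {R : G.V} {α : Fin n → List G.E} (hα : G.MengerSystem S R n α) :
    ∃ P, PS (LAdj G n S) (Sum.inl : Fin n → Fin n ⊕ G.E) (LT G n R) P := by
  let L : Fin n → List (Fin n ⊕ G.E) := fun i => .inl i :: (α i).map .inr
  have hL0 : ∀ i, (L i)[0]? = some (.inl i) := fun i => by simp [L]
  have hLs : ∀ i k, (L i)[k + 1]? = (α i)[k]?.map .inr := fun i k => by simp [L]
  have hchain : ∀ i, (L i).IsChain (LAdj G n S) := by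
    intro i
    obtain ⟨h1, h2, h3, h4⟩ := hα.1 i
    refine List.isChain_cons.2 ⟨?_, ?_⟩
    · intro y hy
      rw [List.head?_map] at hy
      obtain ⟨e, he, rfl⟩ := Option.mem_map.1 hy
      exact h3 e he
    · exact (List.isChain_map _).2 h2
  have hnd : ∀ i, (L i).Nodup := by
    intro i
    have h1 : (L i).IsChain (· < ·) := (hchain i).imp (fun x y => hlt x y)
    exact (List.isChain_iff_pairwise.1 h1).imp (fun h => ne_of_lt h)
  have hdis : ∀ (i j : Fin n) (k l : ℕ) (x : Fin n ⊕ G.E), (L i)[k]? = some x → (L j)[l]? = some x → i = j ∧ k = l := by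
    intro i j k l x h1 h2
    have hij : i = j := by
      by_contra hne
      have m1 := List.mem_of_getElem? h1
      have m2 := List.mem_of_getElem? h2
      rcases x with x | e
      · simp [L] at m1 m2
        exact hne (m1.symm.trans m2)
      · simp [L] at m1 m2
        exact hα.2 i j hne e m1 m2
    subst hij
    refine ⟨rfl, ?_⟩
    have hk : k < (L i).length := by
      by_contra hc
      rw [List.getElem?_eq_none (by omega)] at h1
      cases h1
    exact (List.getElem?_inj hk (hnd i)).1 (h1.trans h2.symm)
  let P : Fin n ⊕ G.E → Fin n ⊕ G.E → Prop :=
    fun x y => ∃ (i : Fin n) (k : ℕ), (L i)[k]? = some x ∧ (L i)[k + 1]? = some y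
  have memL : ∀ x, Mem Sum.inl P x ↔ ∃ (i : Fin n) (k : ℕ), (L i)[k]? = some x := by
    intro x
    constructor
    · rintro (⟨i, rfl⟩ | ⟨w, i, k, h1, h2⟩)
      · exact ⟨i, 0, hL0 i⟩
      · exact ⟨i, k + 1, h2⟩
    · rintro ⟨i, k, h⟩
      rcases k with _ | k
      · rw [hL0] at h
        left; exact ⟨i, Option.some.inj h⟩
      · right
        have hk : k + 1 < (L i).length := by
          by_contra hc
          rw [List.getElem?_eq_none (by omega)] at h
          cases h
        exact ⟨(L i)[k], i, k, List.getElem?_eq_getElem _, h⟩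
  refine ⟨P, ?_, ?_, ?_, ?_, ?_, ?_⟩
  · rintro x y ⟨i, k, h1, h2⟩
    obtain ⟨hk1, rfl⟩ := List.getElem?_eq_some_iff.1 h1
    obtain ⟨hk2, rfl⟩ := List.getElem?_eq_some_iff.1 h2
    exact List.isChain_iff_getElem.1 (hchain i) k hk2
  · rintro x x' y ⟨i, k, h1, h2⟩ ⟨j, l, h3, h4⟩
    obtain ⟨rfl, h5⟩ := hdis _ _ _ _ _ h2 h4
    have : k = l := by omega
    subst this
    exact Option.some.inj (h1.symm.trans h3)
  · rintro x y y' ⟨i, k, h1, h2⟩ ⟨j, l, h3, h4⟩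
    obtain ⟨rfl, rfl⟩ := hdis _ _ _ _ _ h1 h3
    exact Option.some.inj (h2.symm.trans h4)
  · rintro x j ⟨i, k, h1, h2⟩
    rw [hLs] at h2
    obtain ⟨e, -, he⟩ := Option.map_eq_some_iff.1 h2
    cases he
  · rintro x y ⟨i, k, h1, h2⟩
    exact (memL x).2 ⟨i, k, h1⟩
  · intro x hx
    obtain ⟨i, k, h⟩ := (memL x).1 hx
    by_cases hk : k + 1 < (L i).length
    · left
      exact ⟨(L i)[k + 1], i, k, h, List.getElem?_eq_getElem _⟩
    · right
      obtain ⟨hk1, hx1⟩ := List.getElem?_eq_some_iff.1 h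
      obtain ⟨h1, h2, h3, h4⟩ := hα.1 i
      have hlen : (L i).length = (α i).length + 1 := by simp [L]
      have hpos : 0 < (α i).length := List.length_pos_iff.2 h1
      obtain ⟨m, rfl⟩ : ∃ m, k = m + 1 := ⟨k - 1, by omega⟩
      rw [hLs] at h
      obtain ⟨e, he, rfl⟩ := Option.map_eq_some_iff.1 h
      refine h4 e ?_
      rw [List.getLast?_eq_getElem?]
      have : (α i).length - 1 = m := by omega
      rw [this]; exact he

lemma chain_rtg {E : Type} {P : E → E → Prop} {x : E} {l : List E} (h : (x :: l).IsChain P) :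
    ∀ y ∈ l, ReflTransGen P x y := by
  induction l generalizing x with
  | nil => simp
  | cons z l ih =>
    rw [List.isChain_cons_cons] at h
    intro y hy
    rcases List.mem_cons.1 hy with rfl | hy
    · exact .single h.1
    · exact (ih h.2 y hy).head h.1

lemma chain_inr {P : Fin n ⊕ G.E → Fin n ⊕ G.E → Prop}
    (hP : ∀ x y, P x y → LAdj G n S x y) {x : Fin n ⊕ G.E} {l : List (Fin n ⊕ G.E)}
    (h : (x :: l).IsChain P) : ∃ p : List G.E, l = p.map .inr := by
  induction l generalizing x with
  | nil => exact ⟨[], rfl⟩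
  | cons z l ih =>
    rw [List.isChain_cons_cons] at h
    obtain ⟨p, rfl⟩ := ih h.2
    obtain ⟨e, rfl⟩ := ladj_tgt (hP _ _ h.1)
    exact ⟨e :: p, rfl⟩

lemma ofPS [LinearOrder (Fin n ⊕ G.E)] [Fintype G.E]
    (hlt : ∀ x y : Fin n ⊕ G.E, LAdj G n S x y → x < y) (hn : 0 < n)
    {R : G.V} {P : Fin n ⊕ G.E → Fin n ⊕ G.E → Prop}
    (hP : PS (LAdj G n S) (Sum.inl : Fin n → Fin n ⊕ G.E) (LT G n R) P) :
    ∃ α : Fin n → List G.E, G.MengerSystem S R n α ∧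
      ∀ i f e, [f, e] <:+: α i → P (.inr f) (.inr e) := by
  obtain ⟨a, ha, huni⟩ := hP.idx hlt hn Sum.inl_injective
  have ex : ∀ x, Mem Sum.inl P x → ∃ l, (x :: l).IsChain P ∧ ∀ y ∈ (x :: l).getLast?, LT G n R y := by
    intro x
    induction x using (wellFounded_gt (α := Fin n ⊕ G.E)).induction with
    | _ x ih =>
      intro hx
      rcases hP.fin x hx with ⟨y, hy⟩ | hT
      · obtain ⟨l, h1, h2⟩ := ih y (hlt _ _ (hP.adj _ _ hy)) (Or.inr ⟨x, hy⟩)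
        refine ⟨y :: l, List.isChain_cons_cons.2 ⟨hy, h1⟩, ?_⟩
        rwa [List.getLast?_cons_of_ne_nil (by simp)]
      · exact ⟨[], by simp, by simpa using hT⟩
  have ex2 : ∀ i : Fin n, ∃ p : List G.E, ((Sum.inl i : Fin n ⊕ G.E) :: p.map .inr).IsChain P ∧
      ∀ y ∈ ((Sum.inl i : Fin n ⊕ G.E) :: p.map .inr).getLast?, LT G n R y := by
    intro i
    obtain ⟨l, h1, h2⟩ := ex (.inl i) (Or.inl ⟨i, rfl⟩)
    obtain ⟨p, rfl⟩ := chain_inr hP.adj h1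
    exact ⟨p, h1, h2⟩
  choose α h1 h2 using ex2
  have hne : ∀ i, α i ≠ [] := by
    intro i hi
    have := h2 i
    rw [hi] at this
    simpa [LT] using this
  refine ⟨α, ⟨fun i => ⟨hne i, ?_, ?_, ?_⟩, ?_⟩, ?_⟩
  · have := (List.isChain_cons.1 (h1 i)).2
    have := (List.isChain_map _).1 this
    exact this.imp (fun e f h => hP.adj (.inr e) (.inr f) h)
  · intro e he
    have := (List.isChain_cons.1 (h1 i)).1 (.inr e) (by rw [List.head?_map]; exact Option.mem_map_of_mem _ he)
    exact hP.adj _ _ this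
  · intro e he
    refine h2 i (.inr e) ?_
    rw [List.getLast?_cons_of_ne_nil (by simpa using hne i), List.getLast?_map]
    exact Option.mem_map_of_mem _ he
  · intro i j hij e hi hj
    have e1 := huni _ _ (chain_rtg (h1 i) (.inr e) (List.mem_map_of_mem hi))
    have e2 := huni _ _ (chain_rtg (h1 j) (.inr e) (List.mem_map_of_mem hj))
    exact hij (e1.symm.trans e2)
  · intro i f e h
    have h3 := (List.isChain_map _).1 (List.isChain_cons.1 (h1 i)).2
    have := h3.infix h
    simpa using this

end graph
end MM

/-- For every positive integer `n`, `M*(n, n) ≤ ⌈n/2⌉ · (n² − 4n + 5)`: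
in every acyclic graph with a single source, two distinct sinks and min-cut `n` to each
sink, some choice of the two Menger path systems yields at most this many mergings.
(Note `n² − 4n + 5 = n² + 5 − 4n > 0`, and `⌈n/2⌉ = (n + 1)/2` in natural division.) -/
theorem Mstar_upper (n : ℕ) (hn : 0 < n) :
    MstarAtMost ![n, n] ((n + 1) / 2 * (n ^ 2 + 5 - 4 * n)) := by
  intro G S R hG hS
  obtain ⟨hac, -, hcut⟩ := hG
  letI : Fintype G.E := G.fintE
  obtain ⟨α, hα⟩ := (hcut 0).1
  obtain ⟨β, hβ⟩ := (hcut 1).1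
  rw [hS 1 0] at hβ
  obtain ⟨L, hlt⟩ := MM.exLin (n := n) (S := S 0) hac
  obtain ⟨P, Q, hP, hQ, hcard⟩ := MM.exGood hlt hn Sum.inl_injective
    (MM.toPS hlt (α := α) hα) (MM.toPS hlt (α := β) hβ)
  obtain ⟨α', hα', iα⟩ := MM.ofPS hlt hn hP
  obtain ⟨β', hβ', iβ⟩ := MM.ofPS hlt hn hQ
  let γ : (i : Fin 2) → Fin (![n, n] i) → List G.E :=
    Fin.cons (α := fun i : Fin 2 => Fin (![n, n] i) → List G.E) α'
      (Fin.cons (α := fun i : Fin 1 => Fin (![n, n] i.succ) → List G.E) β' (fun i => i.elim0))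
  refine ⟨γ, ?_, ?_⟩
  · intro i
    fin_cases i
    · exact hα'
    · have : G.MengerSystem (S 1) (R 1) n β' := by rw [hS 1 0]; exact hβ'
      exact this
  · refine le_trans ?_ hcard
    unfold MultiDigraph.mergingCount
    rw [← Set.ncard_image_of_injective _ (Sum.inr_injective (α := Fin n) (β := G.E))]
    refine Set.ncard_le_ncard ?_ (Set.toFinite _)
    rintro _ ⟨e, ⟨i, j, hij, u, v, f, g, hfg, h1, h2⟩, rfl⟩
    fin_cases i <;> fin_cases j
    · exact absurd rfl hij
    · exact ⟨.inr f, .inr g, fun h => hfg (Sum.inr_injective h), iα u f e h1, iβ v g e h2⟩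
    · exact ⟨.inr g, .inr f, fun h => hfg (Sum.inr_injective h).symm, iα v g e h2, iβ u f e h1⟩
    · exact absurd rfl hij
end
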